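/- Let (X, ℝ, α) be a one-parameter C*-dynamical system such that sp(α) contains more than three points and X^α([0,∞)) is a maximal norm-closed subalgebra of X, and let Y be a norm-closed α-invariant α-simple two-sided ideal of X with Y^α((0,∞)) = X^α((0,∞)) and Y + X^α([0,∞)) norm-dense in X. Let Z be either X itself or a nonzero α-invariant hereditary C*-subalgebra of Y. Then for every γ ≥ 0 with sp(α) ∩ (γ, ∞) ≠ ∅, the closed linear span of X^α((−∞,−γ)) Z X^α((γ,∞)) equals Y, and the closed linear span of X^α((γ,∞)) Z X^α((−∞,−γ)) equals Y. -/

import Mathlib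

open MeasureTheory Set Filter Topology Pointwise

noncomputable section

namespace PeligradMax

variable {X : Type*} [NonUnitalNormedRing X] [StarRing X] [CStarRing X]
  [NormedSpace ℂ X] [IsScalarTower ℂ X X] [SMulCommClass ℂ X X] [StarModule ℂ X]
  [CompleteSpace X] [PartialOrder X] [StarOrderedRing X]

/-- A one-parameter C*-dynamical system: a group of *-automorphisms of `X`
with norm-continuous orbit maps. -/
structure IsCStarDynSys (α : ℝ → X → X) : Prop where
  map_zero_time : ∀ x, α 0 x = x
  map_add_time : ∀ s t x, α (s + t) x = α s (α t x)
  map_add : ∀ t x y, α t (x + y) = α t x + α t y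
  map_smulc : ∀ (t : ℝ) (c : ℂ) (x : X), α t (c • x) = c • α t x
  map_mul : ∀ t x y, α t (x * y) = α t x * α t y
  map_star : ∀ t x, α t (star x) = star (α t x)
  continuous_orbit : ∀ x, Continuous fun t => α t x

/-- Closed linear span. -/
def ClosedSpan (S : Set X) : Set X := closure ((Submodule.span ℂ S : Submodule ℂ X) : Set X)

def MulSet2 (S T : Set X) : Set X := {z | ∃ s ∈ S, ∃ t ∈ T, z = s * t}

def MulSet3 (S T R : Set X) : Set X := {z | ∃ s ∈ S, ∃ t ∈ T, ∃ r ∈ R, z = s * t * r}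

/-- Fourier transform of an integrable function. -/
def fourierT (f : ℝ → ℂ) (γ : ℝ) : ℂ := ∫ t : ℝ, f t * Complex.exp (-(Complex.I * γ * t))

/-- `α_f(x) = ∫ f(t) α_t(x) dt`. -/
def smear (α : ℝ → X → X) (f : ℝ → ℂ) (x : X) : X := ∫ t : ℝ, f t • α t x

/-- Arveson spectrum of an element. -/
def elemSpec (α : ℝ → X → X) (x : X) : Set ℝ :=
  {γ | ∀ f : ℝ → ℂ, Integrable f → smear α f x = 0 → fourierT f γ = 0}

/-- Spectral subspace associated with a closed set `F ⊆ ℝ`. -/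
def specC (α : ℝ → X → X) (F : Set ℝ) : Set X := {x | elemSpec α x ⊆ F}

/-- Spectral subspace of the subset `S` associated with an open set `U ⊆ ℝ`. -/
def specO (α : ℝ → X → X) (S : Set X) (U : Set ℝ) : Set X :=
  ClosedSpan {y | ∃ x ∈ S, ∃ f : ℝ → ℂ, Integrable f ∧
    IsCompact (tsupport (fourierT f)) ∧ tsupport (fourierT f) ⊆ U ∧ y = smear α f x}

/-- The fixed point algebra `X^α`. -/
def fixedPts (α : ℝ → X → X) : Set X := {x | ∀ t, α t x = x}

/-- The Arveson spectrum of the action restricted to `S`. -/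
def actSpec (α : ℝ → X → X) (S : Set X) : Set ℝ :=
  {γ : ℝ | ∀ ε > (0 : ℝ), S ∩ specC α (Icc (γ - ε) (γ + ε)) ≠ ({0} : Set X)}

def Invariant (α : ℝ → X → X) (S : Set X) : Prop := ∀ t : ℝ, ∀ x ∈ S, α t x ∈ S

def IsSubalgebra (B : Set X) : Prop :=
  (0 : X) ∈ B ∧ (∀ x ∈ B, ∀ y ∈ B, x + y ∈ B) ∧
  (∀ c : ℂ, ∀ x ∈ B, c • x ∈ B) ∧ ∀ x ∈ B, ∀ y ∈ B, x * y ∈ B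

def IsStarSubalgebra (B : Set X) : Prop := IsSubalgebra B ∧ ∀ x ∈ B, star x ∈ B

/-- `B` is a hereditary C*-subalgebra of the subset `S`. -/
def IsHereditaryIn (S B : Set X) : Prop :=
  B ⊆ S ∧ IsClosed B ∧ IsStarSubalgebra B ∧
  ∀ x ∈ S, ∀ b ∈ B, 0 ≤ x → x ≤ b → x ∈ B

/-- `K` is a norm-closed two-sided ideal of the subset `S`. -/
def IsClosedTwoSidedIdealIn (S K : Set X) : Prop :=
  K ⊆ S ∧ IsClosed K ∧ (0 : X) ∈ K ∧ (∀ x ∈ K, ∀ y ∈ K, x + y ∈ K) ∧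
  (∀ c : ℂ, ∀ x ∈ K, c • x ∈ K) ∧ ∀ s ∈ S, ∀ k ∈ K, s * k ∈ K ∧ k * s ∈ K

/-- `S` is `α`-simple: no nontrivial norm-closed `α`-invariant two-sided ideals. -/
def AlphaSimple (α : ℝ → X → X) (S : Set X) : Prop :=
  ∀ K : Set X, IsClosedTwoSidedIdealIn S K → Invariant α K → K = ({0} : Set X) ∨ K = S

/-- The strong Arveson spectrum of the action restricted to `B`. -/
def strongSpec (α : ℝ → X → X) (B : Set X) : Set ℝ :=
  {γ : ℝ | ∀ ε > (0 : ℝ),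
    ClosedSpan (MulSet3 (star '' (B ∩ specC α (Icc (γ - ε) (γ + ε)))) B
      (B ∩ specC α (Icc (γ - ε) (γ + ε)))) = B}

/-- The strong Connes spectrum of the action restricted to `S`. -/
def ConnesSpec (α : ℝ → X → X) (S : Set X) : Set ℝ :=
  ⋂ B ∈ {B : Set X | IsHereditaryIn S B ∧ B ≠ ({0} : Set X) ∧ Invariant α B},
    strongSpec α B

def IsMaximalClosedSubalgebra (B : Set X) : Prop :=
  IsClosed B ∧ IsSubalgebra B ∧ B ≠ (univ : Set X) ∧
  ∀ W : Set X, IsClosed W → IsSubalgebra W → B ⊆ W → W = B ∨ W = univ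

/-- The spectral Condition 4.3. -/
def Condition43 (α : ℝ → X → X) : Prop :=
  (∃ γ₀ : ℝ, 0 < γ₀ ∧ actSpec α (univ : Set X) = ({-γ₀, 0, γ₀} : Set ℝ) ∧
    IsClosedTwoSidedIdealIn (fixedPts α)
      (ClosedSpan (MulSet2 (specC α ({γ₀} : Set ℝ)) (star '' specC α ({γ₀} : Set ℝ)))) ∧
    ∀ K : Set X,
      IsClosedTwoSidedIdealIn
        (ClosedSpan (MulSet2 (specC α ({γ₀} : Set ℝ)) (star '' specC α ({γ₀} : Set ℝ)))) K →
      K = ({0} : Set X) ∨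
        K = ClosedSpan (MulSet2 (specC α ({γ₀} : Set ℝ)) (star '' specC α ({γ₀} : Set ℝ)))) ∨
  (∃ Y : Set X, IsClosedTwoSidedIdealIn (univ : Set X) Y ∧ Invariant α Y ∧ AlphaSimple α Y ∧
    specO α Y (Ioi (0 : ℝ)) = specO α (univ : Set X) (Ioi (0 : ℝ)) ∧
    actSpec α Y = ConnesSpec α Y ∧
    closure (Y + specC α (Ici (0 : ℝ))) = (univ : Set X))

set_option linter.unusedSectionVars false

/-! ### Scalar Fourier analysis -/

/-- Smooth compactly supported symbols. -/
structure IsTest (φ : ℝ → ℂ) : Prop where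
  smooth : ContDiff ℝ (⊤ : ℕ∞) φ
  compact : HasCompactSupport φ

/-- The inverse Fourier transform, normalised so that `fourierT (kern φ) = φ`. -/
def kern (φ : ℝ → ℂ) (t : ℝ) : ℂ :=
  (1 / (2 * Real.pi) : ℝ) * ∫ p : ℝ, φ p * Complex.exp (Complex.I * p * t)

lemma fourierT_eq (f : ℝ → ℂ) (γ : ℝ) :
    fourierT f γ = FourierTransform.fourier f (γ / (2 * Real.pi)) := by
  rw [Real.fourier_real_eq_integral_exp_smul, fourierT]
  congr 1
  ext t
  rw [smul_eq_mul, mul_comm]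
  congr 2
  have : (Real.pi : ℂ) ≠ 0 := by exact_mod_cast Real.pi_ne_zero
  push_cast
  field_simp

lemma kern_eq (φ : ℝ → ℂ) (t : ℝ) :
    kern φ t = (1 / (2 * Real.pi) : ℝ) *
      FourierTransformInv.fourierInv φ (t / (2 * Real.pi)) := by
  rw [Real.fourierInv_eq', kern]
  congr 2
  ext p
  rw [smul_eq_mul, mul_comm]
  congr 2
  have : (Real.pi : ℂ) ≠ 0 := by exact_mod_cast Real.pi_ne_zero
  simp
  field_simp

namespace IsTest

variable {φ ψ : ℝ → ℂ}

lemma continuous (hφ : IsTest φ) : Continuous φ := hφ.smooth.continuous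

lemma integrable (hφ : IsTest φ) : Integrable φ :=
  hφ.continuous.integrable_of_hasCompactSupport hφ.compact

lemma kern_schwartz (hφ : IsTest φ) : ∃ k : SchwartzMap ℝ ℂ,
    FourierTransform.fourier (k : ℝ → ℂ) = φ ∧
    ∀ t, kern φ t = (1 / (2 * Real.pi) : ℝ) * k (t / (2 * Real.pi)) := by
  refine ⟨FourierTransformInv.fourierInv (hφ.compact.toSchwartzMap hφ.smooth), ?_, fun t => ?_⟩
  · rw [← SchwartzMap.fourier_coe, FourierTransform.fourier_fourierInv_eq]
    rfl
  · rw [kern_eq, SchwartzMap.fourierInv_coe]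
    rfl

lemma kern_continuous (hφ : IsTest φ) : Continuous (kern φ) := by
  obtain ⟨k, -, hk⟩ := hφ.kern_schwartz
  rw [funext hk]
  have := k.continuous
  fun_prop

lemma kern_integrable (hφ : IsTest φ) : Integrable (kern φ) := by
  obtain ⟨k, -, hk⟩ := hφ.kern_schwartz
  rw [funext hk]
  have h2 : (2 * Real.pi) ≠ 0 := by positivity
  exact (k.integrable.comp_div h2).const_mul _

lemma fourierT_kern (hφ : IsTest φ) : fourierT (kern φ) = φ := by
  obtain ⟨k, hk1, hk⟩ := hφ.kern_schwartz
  have h2 : (0 : ℝ) < (2 * Real.pi) := by positivity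
  have h3 : (Real.pi : ℂ) ≠ 0 := by exact_mod_cast Real.pi_ne_zero
  ext γ
  rw [← congrFun hk1 γ, Real.fourier_real_eq_integral_exp_smul, fourierT]
  have := Measure.integral_comp_div
    (fun v : ℝ => Complex.exp (((-2 * Real.pi * v * γ : ℝ) : ℂ) * Complex.I) • k v) (2 * Real.pi)
  rw [abs_of_pos h2] at this
  have h4 : ∀ x : ℂ, x = (1 / (2 * Real.pi) : ℝ) • ((2 * Real.pi : ℝ) • x) := fun x => by
    rw [smul_smul, one_div_mul_cancel h2.ne', one_smul]
  rw [h4 (∫ v : ℝ, Complex.exp (((-2 * Real.pi * v * γ : ℝ) : ℂ) * Complex.I) • k v), ← this,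
    ← integral_smul]
  congr 1
  ext t
  rw [hk, smul_eq_mul, Complex.real_smul, mul_assoc, mul_comm (k _)]
  congr 3
  push_cast
  field_simp

lemma mul_left (hφ : IsTest φ) (hψ : ContDiff ℝ (⊤ : ℕ∞) ψ) : IsTest fun p => ψ p * φ p :=
  ⟨hψ.mul hφ.smooth, hφ.compact.mul_left⟩

lemma mul_right (hφ : IsTest φ) (hψ : ContDiff ℝ (⊤ : ℕ∞) ψ) : IsTest fun p => φ p * ψ p :=
  ⟨hφ.smooth.mul hψ, hφ.compact.mul_right⟩

end IsTest

lemma ae_eq_zero_of_fourierT_eq_zero {f : ℝ → ℂ} (hf : Integrable f)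
    (h : ∀ γ, fourierT f γ = 0) : f =ᵐ[volume] 0 := by
  have h2 : (2 * Real.pi) ≠ 0 := by positivity
  have hF : FourierTransform.fourier f = 0 := by
    ext w
    have := h (w * (2 * Real.pi))
    rwa [fourierT_eq, mul_div_cancel_right₀ _ h2] at this
  refine ae_eq_zero_of_integral_contDiff_smul_eq_zero hf.locallyIntegrable fun g hg hgc => ?_
  have hG : IsTest (fun p => (g p : ℂ)) :=
    ⟨Complex.ofRealCLM.contDiff.comp hg, hgc.comp_left Complex.ofReal_zero⟩
  obtain ⟨k, hk, -⟩ := hG.kern_schwartz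
  have key : ∫ ξ, FourierTransform.fourier (k : ℝ → ℂ) ξ • f ξ
      = ∫ x, k x • FourierTransform.fourier f x := by
    simpa using! (VectorFourier.integral_fourierIntegral_smul_eq_flip (L := innerₗ ℝ)
      Real.continuous_fourierChar continuous_inner k.integrable hf)
  rw [hF, hk] at key
  simpa using key

lemma integral_smul_eq_of_fourierT_eq {V : Type*} [NormedAddCommGroup V] [NormedSpace ℂ V]
    {f g : ℝ → ℂ} (hf : Integrable f) (hg : Integrable g)
    (h : ∀ γ, fourierT f γ = fourierT g γ) (u : ℝ → V) :
    ∫ t, f t • u t = ∫ t, g t • u t := by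
  have hfg : f - g =ᵐ[volume] 0 := by
    refine ae_eq_zero_of_fourierT_eq_zero (hf.sub hg) fun γ => ?_
    have hb : ∀ k : ℝ → ℂ, Integrable k →
        Integrable fun t : ℝ => k t * Complex.exp (-(Complex.I * γ * t)) := by
      intro k hk
      refine hk.mul_bdd (c := 1) (by fun_prop) (Eventually.of_forall fun t => ?_)
      rw [Complex.norm_exp]
      simp
    have := h γ
    simp only [fourierT, Pi.sub_apply, sub_mul] at this ⊢
    rw [integral_sub (hb f hf) (hb g hg), this, sub_self]
  refine integral_congr_ae ?_
  filter_upwards [hfg] with t ht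
  have h1 : f t = g t := sub_eq_zero.1 (by simpa using ht)
  rw [h1]

/-- Fubini for iterated averages of a bounded continuous function. -/
lemma integral_integral_add {V : Type*} [NormedAddCommGroup V] [NormedSpace ℂ V]
    {f g : ℝ → ℂ} (hf : Integrable f) (hg : Integrable g) {u : ℝ → V} (hu : Continuous u)
    {C : ℝ} (hC : ∀ t, ‖u t‖ ≤ C) :
    ∫ t, f t • ∫ s, g s • u (t + s) =
      ∫ r, (convolution f g (ContinuousLinearMap.mul ℂ ℂ) volume r) • u r := by
  by_cases hV : CompleteSpace V
  swap
  · simp [integral, hV]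
  have h_int : Integrable (fun p : ℝ × ℝ => (f p.2 * g (p.1 - p.2)) • u p.1)
      (volume.prod volume) := by
    have h1 := hf.convolution_integrand (ContinuousLinearMap.mul ℂ ℂ) hg
    refine Integrable.smul_bdd h1 (C := C) ?_ ?_
    · exact (hu.comp continuous_fst).aestronglyMeasurable
    · exact Eventually.of_forall fun p => hC _
  calc ∫ t, f t • ∫ s, g s • u (t + s)
      = ∫ t, ∫ r, (f t * g (r - t)) • u r := by
        congr 1
        ext t
        rw [← integral_smul]
        refine (integral_sub_right_eq_self (fun s => f t • g s • u (t + s)) t).symm.trans ?_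
        congr 1
        ext r
        rw [smul_smul, add_sub_cancel]
    _ = ∫ r, ∫ t, (f t * g (r - t)) • u r := (integral_integral_swap h_int).symm
    _ = _ := by
        congr 1
        ext r
        rw [integral_smul_const]
        rfl

lemma integrable_convolution_mul {f g : ℝ → ℂ} (hf : Integrable f) (hg : Integrable g) :
    Integrable (convolution f g (ContinuousLinearMap.mul ℂ ℂ) volume) :=
  hf.integrable_convolution _ hg

lemma fourierT_convolution {f g : ℝ → ℂ} (hf : Integrable f) (hg : Integrable g) (γ : ℝ) :
    fourierT (convolution f g (ContinuousLinearMap.mul ℂ ℂ) volume) γ =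
      fourierT f γ * fourierT g γ := by
  rw [fourierT_eq, fourierT_eq, fourierT_eq, Real.fourier_mul_convolution_eq hf hg]

/-! ### The smearing calculus -/

lemma isTest_comp_mul {φ : ℝ → ℂ} (hφ : IsTest φ) {ε : ℝ} (hε : ε ≠ 0) :
    IsTest fun p => φ (ε * p) :=
  ⟨hφ.smooth.comp (by fun_prop), hφ.compact.comp_homeomorph (Homeomorph.mulLeft₀ ε hε)⟩

lemma isTest_comp_sub {φ : ℝ → ℂ} (hφ : IsTest φ) (γ : ℝ) : IsTest fun p => φ (p - γ) :=
  ⟨hφ.smooth.comp (by fun_prop), hφ.compact.comp_homeomorph (Homeomorph.subRight γ)⟩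

lemma isTest_conj_neg {φ : ℝ → ℂ} (hφ : IsTest φ) : IsTest fun p => star (φ (-p)) :=
  ⟨Complex.conjCLE.contDiff.comp (hφ.smooth.comp contDiff_neg),
    (hφ.compact.comp_homeomorph (Homeomorph.neg ℝ)).comp_left (g := star) (star_zero ℂ)⟩

lemma kern_comp_mul (φ : ℝ → ℂ) {ε : ℝ} (hε : 0 < ε) (t : ℝ) :
    kern (fun p => φ (ε * p)) t = (ε⁻¹ : ℝ) * kern φ (ε⁻¹ * t) := by
  have := Measure.integral_comp_mul_left
    (fun p : ℝ => φ p * Complex.exp (Complex.I * p * (ε⁻¹ * t : ℝ))) ε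
  have hε' : (ε : ℂ) ≠ 0 := by exact_mod_cast hε.ne'
  rw [abs_of_pos (inv_pos.2 hε)] at this
  rw [kern, kern, mul_left_comm, ← Complex.real_smul (x := ε⁻¹), ← this]
  congr 2
  ext p
  congr 2
  push_cast
  field_simp

lemma kern_comp_sub (φ : ℝ → ℂ) (γ t : ℝ) :
    kern (fun p => φ (p - γ)) t = Complex.exp (Complex.I * γ * t) * kern φ t := by
  rw [kern, kern, mul_left_comm]
  congr 1
  refine Eq.trans ?_ (integral_const_mul _ _)
  refine (integral_add_right_eq_self (μ := volume)
    (fun p : ℝ => φ (p - γ) * Complex.exp (Complex.I * p * t)) γ).symm.trans ?_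
  congr 1
  ext p
  rw [add_sub_cancel_right, mul_left_comm, ← Complex.exp_add]
  congr 2
  push_cast
  ring

lemma kern_conj_neg (φ : ℝ → ℂ) (t : ℝ) :
    kern (fun p => star (φ (-p))) t = star (kern φ t) := by
  rw [kern, kern, star_mul', Complex.star_def, Complex.conj_ofReal, ← integral_conj]
  congr 1
  rw [← integral_neg_eq_self]
  congr 1
  ext p
  rw [map_mul, ← Complex.exp_conj]
  simp

/-- Translation of the kernel of a test symbol is continuous in `L¹`. -/
lemma tendsto_integral_kern_sub {χ : ℝ → ℂ} (hχ : IsTest χ) :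
    Tendsto (fun u : ℝ => ∫ t, ‖kern χ (t - u) - kern χ t‖) (𝓝 0) (𝓝 0) := by
  obtain ⟨K, -, hK⟩ := hχ.kern_schwartz
  have hπ : (1 : ℝ) ≤ 2 * Real.pi := by linarith [Real.pi_gt_three]
  have hπ0 : (0 : ℝ) < 2 * Real.pi := by linarith
  obtain ⟨C, hC⟩ : ∃ C, ∀ x, (1 + ‖x‖) ^ 2 * ‖K x‖ ≤ C := by
    obtain ⟨a, -, ha⟩ := K.decay 0 0
    obtain ⟨b, -, hb⟩ := K.decay 2 0
    refine ⟨2 * a + 2 * b, fun x => ?_⟩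
    have h1 := ha x
    have h2 := hb x
    simp only [norm_iteratedFDeriv_zero, pow_zero, one_mul] at h1 h2
    nlinarith [norm_nonneg (K x), sq_nonneg (1 - ‖x‖),
      mul_nonneg (sq_nonneg (1 - ‖x‖)) (norm_nonneg (K x))]
  have hC0 : 0 ≤ C := le_trans (by positivity) (hC 0)
  have hbound : ∀ t u : ℝ, |u| ≤ 1 →
      ‖K ((t - u) / (2 * Real.pi))‖ ≤ 4 * C * (1 + ‖t / (2 * Real.pi)‖) ^ (-2 : ℝ) := by
    intro t u hu
    set x := t / (2 * Real.pi) with hx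
    set v := u / (2 * Real.pi) with hv
    have hv1 : |v| ≤ 1 := by
      rw [hv, abs_div, abs_of_pos hπ0]
      exact (div_le_one hπ0).2 (hu.trans hπ)
    have hxv : (t - u) / (2 * Real.pi) = x - v := by rw [sub_div]
    rw [hxv, Real.rpow_neg (by positivity), ← div_eq_mul_inv, le_div_iff₀ (by positivity)]
    norm_cast
    have h1 : 1 + ‖x‖ ≤ 2 * (1 + ‖x - v‖) := by
      have : ‖x‖ ≤ ‖x - v‖ + ‖v‖ := by simpa using norm_add_le (x - v) v
      have h3 : ‖v‖ ≤ 1 := hv1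
      linarith [norm_nonneg (x - v)]
    have h2 : (1 + ‖x‖) ^ 2 ≤ 4 * (1 + ‖x - v‖) ^ 2 := by
      calc (1 + ‖x‖) ^ 2 ≤ (2 * (1 + ‖x - v‖)) ^ 2 := by gcongr
        _ = _ := by ring
    calc ‖K (x - v)‖ * (1 + ‖x‖) ^ 2 ≤ ‖K (x - v)‖ * (4 * (1 + ‖x - v‖) ^ 2) := by gcongr
      _ = 4 * ((1 + ‖x - v‖) ^ 2 * ‖K (x - v)‖) := by ring
      _ ≤ 4 * C := by linarith [hC (x - v)]
  have hlim : Tendsto (fun u : ℝ => ∫ t, ‖kern χ (t - u) - kern χ t‖) (𝓝 0)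
      (𝓝 (∫ t : ℝ, ‖kern χ (t - 0) - kern χ t‖)) := by
    refine tendsto_integral_filter_of_dominated_convergence
      (fun t => (1 / (2 * Real.pi)) * (4 * C * (1 + ‖t / (2 * Real.pi)‖) ^ (-2 : ℝ)) +
        (1 / (2 * Real.pi)) * (4 * C * (1 + ‖t / (2 * Real.pi)‖) ^ (-2 : ℝ))) ?_ ?_ ?_ ?_
    · refine Eventually.of_forall fun u => Continuous.aestronglyMeasurable ?_
      have := hχ.kern_continuous
      fun_prop
    · filter_upwards [Metric.closedBall_mem_nhds (0 : ℝ) one_pos] with u hu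
      refine Eventually.of_forall fun t => ?_
      have hu' : |u| ≤ 1 := by simpa using hu
      rw [norm_norm]
      refine (norm_sub_le _ _).trans (add_le_add ?_ ?_)
      · rw [hK, norm_mul, Complex.norm_real, Real.norm_of_nonneg (by positivity)]
        gcongr
        exact hbound t u hu'
      · rw [hK, norm_mul, Complex.norm_real, Real.norm_of_nonneg (by positivity)]
        gcongr
        simpa using hbound t 0 (by simp)
    · have h1 : Integrable (fun x : ℝ => (1 + ‖x‖) ^ (-2 : ℝ)) :=
        integrable_one_add_norm (by simp)
      have h2 := ((h1.comp_div hπ0.ne').const_mul (4 * C)).const_mul (1 / (2 * Real.pi))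
      exact h2.add h2
    · refine Eventually.of_forall fun t => ?_
      have := hχ.kern_continuous
      exact Continuous.tendsto (f := fun u : ℝ => ‖kern χ (t - u) - kern χ t‖) (by fun_prop) 0
  simpa using hlim

namespace IsCStarDynSys

variable {α : ℝ → X → X} (hα : IsCStarDynSys α)

include hα

lemma norm_le (t : ℝ) (x : X) : ‖α t x‖ ≤ ‖x‖ := by
  let : NonUnitalCStarAlgebra X := {}
  let F : X →⋆ₙₐ[ℂ] X :=
    { toFun := α t
      map_smul' := fun c x => hα.map_smulc t c x
      map_zero' := by simpa using hα.map_smulc t 0 0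
      map_add' := hα.map_add t
      map_mul' := hα.map_mul t
      map_star' := hα.map_star t }
  exact NonUnitalStarAlgHom.norm_apply_le F x

/-- `α t` as a continuous linear map. -/
def clm (t : ℝ) : X →L[ℂ] X :=
  LinearMap.mkContinuous
    { toFun := α t
      map_add' := hα.map_add t
      map_smul' := fun c x => hα.map_smulc t c x } 1 (fun x => by simpa using hα.norm_le t x)

@[simp] lemma clm_apply (t : ℝ) (x : X) : hα.clm t x = α t x := rfl

lemma smear_integrable {f : ℝ → ℂ} (hf : Integrable f) (x : X) :
    Integrable fun t => f t • α t x :=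
  hf.smul_bdd (C := ‖x‖) (hα.continuous_orbit x).aestronglyMeasurable
    (Eventually.of_forall fun t => hα.norm_le t x)

lemma norm_smear_le {f : ℝ → ℂ} (hf : Integrable f) (x : X) :
    ‖smear α f x‖ ≤ (∫ t, ‖f t‖) * ‖x‖ := by
  rw [smear, ← integral_mul_const]
  refine norm_integral_le_of_norm_le (hf.norm.mul_const _) (Eventually.of_forall fun t => ?_)
  rw [norm_smul]
  gcongr
  exact hα.norm_le t x

/-- Smearing with an integrable function, as a continuous linear map. -/
def smearCLM {f : ℝ → ℂ} (hf : Integrable f) : X →L[ℂ] X :=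
  LinearMap.mkContinuous
    { toFun := smear α f
      map_add' := fun x y => by
        simp only [smear]
        rw [← integral_add (hα.smear_integrable hf x) (hα.smear_integrable hf y)]
        simp [hα.map_add]
      map_smul' := fun c x => by
        simp only [smear, RingHom.id_apply]
        rw [← integral_smul]
        simp [hα.map_smulc, smul_comm c] } (∫ t, ‖f t‖) (fun x => hα.norm_smear_le hf x)

@[simp] lemma smearCLM_apply {f : ℝ → ℂ} (hf : Integrable f) (x : X) :
    hα.smearCLM hf x = smear α f x := rfl

lemma apply_smear {f : ℝ → ℂ} (hf : Integrable f) (t : ℝ) (x : X) :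
    α t (smear α f x) = ∫ s, f s • α (t + s) x := by
  rw [smear, ← hα.clm_apply, ← ContinuousLinearMap.integral_comp_comm _ (hα.smear_integrable hf x)]
  simp [hα.map_add_time]

lemma apply_smear' {f : ℝ → ℂ} (hf : Integrable f) (t : ℝ) (x : X) :
    α t (smear α f x) = smear α f (α t x) := by
  rw [hα.apply_smear hf, smear]
  simp only [add_comm t, hα.map_add_time]

lemma smear_smear {f g h : ℝ → ℂ} (hf : Integrable f) (hg : Integrable g) (hh : Integrable h)
    (hfg : ∀ γ, fourierT h γ = fourierT f γ * fourierT g γ) (x : X) :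
    smear α f (smear α g x) = smear α h x := by
  have h1 : smear α f (smear α g x) = ∫ t, f t • ∫ s, g s • α (t + s) x := by
    simp only [smear.eq_1 α f, hα.apply_smear hg]
  rw [h1, integral_integral_add hf hg (hα.continuous_orbit x) (fun t => hα.norm_le t x), smear]
  exact integral_smul_eq_of_fourierT_eq (integrable_convolution_mul hf hg) hh
    (fun γ => by rw [fourierT_convolution hf hg, hfg]) _

omit hα in
lemma smear_congr {f g : ℝ → ℂ} (hf : Integrable f) (hg : Integrable g)
    (h : ∀ γ, fourierT f γ = fourierT g γ) (x : X) : smear α f x = smear α g x :=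
  integral_smul_eq_of_fourierT_eq hf hg h _

lemma smear_comm {f g : ℝ → ℂ} (hf : Integrable f) (hg : Integrable g) (x : X) :
    smear α f (smear α g x) = smear α g (smear α f x) := by
  rw [hα.smear_smear hf hg (integrable_convolution_mul hf hg) (fourierT_convolution hf hg),
    hα.smear_smear hg hf (integrable_convolution_mul hf hg)
      (fun γ => by rw [fourierT_convolution hf hg, mul_comm])]

lemma smear_kern_kern {φ ψ : ℝ → ℂ} (hφ : IsTest φ) (hψ : IsTest ψ) (x : X) :
    smear α (kern φ) (smear α (kern ψ) x) = smear α (kern fun p => φ p * ψ p) x :=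
  hα.smear_smear hφ.kern_integrable hψ.kern_integrable (hφ.mul_right hψ.smooth).kern_integrable
    (fun γ => by
      rw [hφ.fourierT_kern, hψ.fourierT_kern, (hφ.mul_right hψ.smooth).fourierT_kern]) x

omit hα in
lemma smear_kern_zero (x : X) : smear α (kern fun _ => 0) x = 0 := by
  simp [smear, kern]

omit hα in
lemma smear_kern_comp_mul (φ : ℝ → ℂ) {ε : ℝ} (hε : 0 < ε) (x : X) :
    smear α (kern fun p => φ (ε * p)) x = ∫ s, kern φ s • α (ε * s) x := by
  have := Measure.integral_comp_mul_left (fun s => kern φ s • α (ε * s) x) ε⁻¹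
  rw [inv_inv, abs_of_pos hε] at this
  have h2 : ∀ y : X, y = ε⁻¹ • ε • y := fun y => by rw [smul_smul, inv_mul_cancel₀ hε.ne', one_smul]
  rw [h2 (∫ s, kern φ s • α (ε * s) x), ← this, ← integral_smul, smear]
  congr 1
  ext t
  rw [kern_comp_mul φ hε, mul_inv_cancel_left₀ hε.ne', ← Complex.real_smul, smul_assoc]

lemma tendsto_smear_kern_comp_mul {φ : ℝ → ℂ} (hφ : IsTest φ) (x : X) :
    Tendsto (fun ε : ℝ => smear α (kern fun p => φ (ε * p)) x) (𝓝[>] 0) (𝓝 (φ 0 • x)) := by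
  have h0 : ∫ s, kern φ s • α (0 * s) x = φ 0 • x := by
    simp only [zero_mul, hα.map_zero_time]
    rw [integral_smul_const]
    have := congrFun hφ.fourierT_kern 0
    simp only [fourierT, Complex.ofReal_zero, mul_zero, zero_mul, neg_zero, Complex.exp_zero,
      mul_one] at this
    rw [this]
  have h1 : Tendsto (fun ε : ℝ => ∫ s, kern φ s • α (ε * s) x) (𝓝 0) (𝓝 (φ 0 • x)) := by
    rw [← h0]
    refine tendsto_integral_filter_of_dominated_convergence (fun s => ‖kern φ s‖ * ‖x‖) ?_ ?_ ?_ ?_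
    · refine Eventually.of_forall fun ε => (hφ.kern_continuous.smul
        ((hα.continuous_orbit x).comp (continuous_const.mul continuous_id))).aestronglyMeasurable
    · refine Eventually.of_forall fun ε => Eventually.of_forall fun s => ?_
      rw [norm_smul]
      gcongr
      exact hα.norm_le _ x
    · exact hφ.kern_integrable.norm.mul_const _
    · refine Eventually.of_forall fun s => Tendsto.const_smul ?_ _
      exact ((hα.continuous_orbit x).comp (continuous_id.mul continuous_const)).tendsto 0
  refine (h1.mono_left nhdsWithin_le_nhds).congr' ?_
  filter_upwards [self_mem_nhdsWithin] with ε hε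
  exact (smear_kern_comp_mul φ hε x).symm

lemma norm_smear_kern_comp_mul_le {φ : ℝ → ℂ} (hφ : IsTest φ) {ε : ℝ} (hε : 0 < ε) (x : X) :
    ‖smear α (kern fun p => φ (ε * p)) x‖ ≤ (∫ s, ‖kern φ s‖) * ‖x‖ := by
  rw [smear_kern_comp_mul φ hε, ← integral_mul_const]
  refine norm_integral_le_of_norm_le (hφ.kern_integrable.norm.mul_const _)
    (Eventually.of_forall fun t => ?_)
  rw [norm_smul]
  gcongr
  exact hα.norm_le _ x

lemma star_smear {φ : ℝ → ℂ} (hφ : IsTest φ) (x : X) :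
    star (smear α (kern φ) x) = smear α (kern fun p => star (φ (-p))) (star x) := by
  have := (starL' ℝ : X ≃L[ℝ] X).toContinuousLinearMap.integral_comp_comm
    (hα.smear_integrable hφ.kern_integrable x)
  rw [smear, smear]
  refine this.symm.trans ?_
  congr 1
  ext t
  change star (kern φ t • α t x) = _
  rw [star_smul, kern_conj_neg, hα.map_star]

end IsCStarDynSys

/-! ### Spectral subspaces -/

lemma smear_kern_sub {α : ℝ → X → X} (hα : IsCStarDynSys α) {φ ψ : ℝ → ℂ} (hφ : IsTest φ)
    (hψ : IsTest ψ) (x : X) :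
    smear α (kern fun p => φ p - ψ p) x = smear α (kern φ) x - smear α (kern ψ) x := by
  have h : ∀ {φ : ℝ → ℂ}, IsTest φ → ∀ t : ℝ,
      Integrable fun p : ℝ => φ p * Complex.exp (Complex.I * p * t) := by
    intro φ hφ t
    refine hφ.integrable.mul_bdd (c := 1) (by fun_prop) (Eventually.of_forall fun p => ?_)
    rw [Complex.norm_exp]
    simp
  rw [smear, smear, smear, ← integral_sub (hα.smear_integrable hφ.kern_integrable x)
    (hα.smear_integrable hψ.kern_integrable x)]
  congr 1
  ext t
  rw [← sub_smul, kern, kern, kern, ← mul_sub, ← integral_sub (h hφ t) (h hψ t)]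
  simp only [sub_mul]

/-- A smooth cutoff separating two disjoint closed sets. -/
lemma exists_smooth_cutoff {s t : Set ℝ} (hs : IsClosed s) (ht : IsClosed t)
    (hd : Disjoint s t) : ∃ ρ : ℝ → ℂ, ContDiff ℝ (⊤ : ℕ∞) ρ ∧
      (∀ p ∈ s, ρ =ᶠ[𝓝 p] fun _ => 0) ∧ ∀ p ∈ t, ρ =ᶠ[𝓝 p] fun _ => 1 := by
  obtain ⟨f, h0, h1, -⟩ := exists_contMDiffMap_zero_one_nhds_of_isClosed (n := (⊤ : ℕ∞))
    (modelWithCornersSelf ℝ ℝ) hs ht hd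
  refine ⟨fun p => (f p : ℂ), Complex.ofRealCLM.contDiff.comp f.contMDiff.contDiff,
    fun p hp => ?_, fun p hp => ?_⟩
  · filter_upwards [h0.filter_mono (nhds_le_nhdsSet hp)] with q hq
    simp [hq]
  · filter_upwards [h1.filter_mono (nhds_le_nhdsSet hp)] with q hq
    simp [hq]

/-- A test symbol equal to `1` near a compact set and supported in a given neighbourhood. -/
lemma exists_isTest {K U : Set ℝ} (hK : IsCompact K) (hU : IsOpen U) (hKU : K ⊆ U) :
    ∃ χ : ℝ → ℂ, IsTest χ ∧ tsupport χ ⊆ U ∧ ∀ p ∈ K, χ =ᶠ[𝓝 p] fun _ => 1 := by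
  obtain ⟨L, hL, hKL, hLU⟩ := exists_compact_between hK hU hKU
  obtain ⟨ρ, hρ, h0, h1⟩ := exists_smooth_cutoff (isOpen_interior (s := L)).isClosed_compl
    hK.isClosed (disjoint_compl_left_iff_subset.2 hKL)
  have hsub : tsupport ρ ⊆ L := by
    intro p hp
    by_contra h
    exact notMem_tsupport_iff_eventuallyEq.2 (h0 p fun h' => h (interior_subset h')) hp
  exact ⟨ρ, ⟨hρ, hL.of_isClosed_subset (isClosed_tsupport ρ) hsub⟩, hsub.trans hLU, h1⟩

/-- The spectral subspace attached to `F`, tested against smooth symbols only. -/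
def Sp (α : ℝ → X → X) (F : Set ℝ) : Set X :=
  {x | ∀ φ, IsTest φ → Disjoint (tsupport φ) F → smear α (kern φ) x = 0}

lemma Sp_mono {α : ℝ → X → X} {F G : Set ℝ} (h : F ⊆ G) : Sp α F ⊆ Sp α G :=
  fun _ hx φ hφ hd => hx φ hφ (hd.mono_right h)

namespace IsCStarDynSys

variable {α : ℝ → X → X} (hα : IsCStarDynSys α)

include hα

/-- `Sp` as a submodule. -/
def spSubmodule (F : Set ℝ) : Submodule ℂ X where
  carrier := Sp α F
  zero_mem' := fun φ hφ _ => map_zero (hα.smearCLM hφ.kern_integrable)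
  add_mem' := fun {x y} hx hy φ hφ hd => by
    have := _root_.map_add (hα.smearCLM hφ.kern_integrable) x y
    simp only [smearCLM_apply, hx φ hφ hd, hy φ hφ hd, add_zero] at this
    exact this
  smul_mem' := fun c x hx φ hφ hd => by
    have := map_smul (hα.smearCLM hφ.kern_integrable) c x
    simp only [smearCLM_apply, hx φ hφ hd, smul_zero] at this
    exact this

lemma isClosed_Sp (F : Set ℝ) : IsClosed (Sp α F) := by
  have : Sp α F = ⋂ (φ : ℝ → ℂ) (hφ : IsTest φ) (_ : Disjoint (tsupport φ) F),
      {x | hα.smearCLM hφ.kern_integrable x = 0} := by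
    ext x
    simp [Sp]
  rw [this]
  exact isClosed_iInter fun φ => isClosed_iInter fun hφ => isClosed_iInter fun _ =>
    isClosed_eq (ContinuousLinearMap.continuous _) continuous_const

lemma star_mem_Sp {F : Set ℝ} {x : X} (hx : x ∈ Sp α F) : star x ∈ Sp α (-F) := by
  intro φ hφ hd
  have h := hα.star_smear (isTest_conj_neg hφ) x
  simp only [star_star, neg_neg] at h
  rw [← h, hx _ (isTest_conj_neg hφ), star_zero]
  rw [Set.disjoint_left] at hd ⊢
  intro p hp hpF
  refine hd (a := -p) ?_ (by simpa using hpF)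
  contrapose! hp
  rw [notMem_tsupport_iff_eventuallyEq] at hp ⊢
  have h2 : Tendsto (fun p : ℝ => -p) (𝓝 p) (𝓝 (-p)) := continuous_neg.tendsto p
  filter_upwards [h2.eventually hp] with q hq
  simp [hq]

lemma smear_eq_zero {f : ℝ → ℂ} (hf : Integrable f) (h : ∀ γ, fourierT f γ = 0) (x : X) :
    smear α f x = 0 := by
  rw [smear_congr hf (integrable_zero _ _ _) (g := fun _ => 0)
    (fun γ => by rw [h γ]; simp [fourierT])]
  simp [smear]

lemma smear_smear_eq_zero {f g : ℝ → ℂ} (hf : Integrable f) (hg : Integrable g)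
    (h : ∀ γ, fourierT f γ * fourierT g γ = 0) (x : X) : smear α f (smear α g x) = 0 := by
  rw [hα.smear_smear hf hg (integrable_convolution_mul hf hg) (fourierT_convolution hf hg)]
  exact hα.smear_eq_zero (integrable_convolution_mul hf hg)
    (fun γ => by rw [fourierT_convolution hf hg, h]) x

lemma smear_mem_Sp {f : ℝ → ℂ} (hf : Integrable f) (x : X) {F : Set ℝ}
    (hF : tsupport (fourierT f) ⊆ F) : smear α f x ∈ Sp α F := by
  intro φ hφ hd
  refine hα.smear_smear_eq_zero hφ.kern_integrable hf (fun γ => ?_) x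
  rw [hφ.fourierT_kern]
  by_contra h
  exact Set.disjoint_left.1 hd (subset_tsupport _ (left_ne_zero_of_mul h))
    (hF (subset_tsupport _ (right_ne_zero_of_mul h)))

lemma smear_kern_mem_Sp {φ : ℝ → ℂ} (hφ : IsTest φ) {x : X} {F : Set ℝ} (hx : x ∈ Sp α F) :
    smear α (kern φ) x ∈ Sp α (F ∩ tsupport φ) := by
  intro η hη hd
  rw [hα.smear_kern_kern hη hφ]
  refine hx _ (hη.mul_right hφ.smooth) ?_
  have h1 : tsupport (fun p => η p * φ p) ⊆ tsupport η := tsupport_mul_subset_left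
  have h2 : tsupport (fun p => η p * φ p) ⊆ tsupport φ := tsupport_mul_subset_right
  rw [Set.disjoint_left] at hd ⊢
  exact fun p hp hpF => hd (h1 hp) ⟨hpF, h2 hp⟩

lemma smear_kern_eq_self {F : Set ℝ} {x : X} (hx : x ∈ Sp α F) {χ : ℝ → ℂ} (hχ : IsTest χ)
    (h1 : ∀ p ∈ F, χ =ᶠ[𝓝 p] fun _ => 1) : smear α (kern χ) x = x := by
  obtain ⟨φ, hφ, -, hφ0⟩ := exists_isTest (isCompact_singleton (x := (0 : ℝ))) isOpen_univ
    (subset_univ _)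
  have hφ0' : φ 0 = 1 := (hφ0 0 rfl).eq_of_nhds
  have key : ∀ ε : ℝ, 0 < ε → smear α (kern fun p => φ (ε * p)) (smear α (kern χ) x) =
      smear α (kern fun p => φ (ε * p)) x := by
    intro ε hε
    have hφε := isTest_comp_mul hφ hε.ne'
    have h2 := hφε.mul_right hχ.smooth
    rw [hα.smear_kern_kern hφε hχ, eq_comm, ← sub_eq_zero, ← smear_kern_sub hα hφε h2]
    refine hx _ ⟨hφε.smooth.sub h2.smooth, hφε.compact.sub h2.compact⟩ ?_
    rw [Set.disjoint_right]
    intro p hp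
    rw [notMem_tsupport_iff_eventuallyEq]
    filter_upwards [h1 p hp] with q hq
    simp [hq]
  have l1 := hα.tendsto_smear_kern_comp_mul hφ (smear α (kern χ) x)
  have l2 := hα.tendsto_smear_kern_comp_mul hφ x
  rw [hφ0', one_smul] at l1 l2
  refine tendsto_nhds_unique l1 (l2.congr' ?_)
  filter_upwards [self_mem_nhdsWithin] with ε hε
  exact (key ε hε).symm

end IsCStarDynSys

namespace IsCStarDynSys

variable {α : ℝ → X → X} (hα : IsCStarDynSys α)

include hα

lemma smear_eq_zero_union {U V : Set ℝ} {x : X} (hU : IsOpen U) (hV : IsOpen V)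
    (hxU : ∀ φ, IsTest φ → tsupport φ ⊆ U → smear α (kern φ) x = 0)
    (hxV : ∀ φ, IsTest φ → tsupport φ ⊆ V → smear α (kern φ) x = 0) :
    ∀ φ, IsTest φ → tsupport φ ⊆ U ∪ V → smear α (kern φ) x = 0 := by
  intro φ hφ hsub
  have hK := isClosed_tsupport φ
  obtain ⟨ρ, hρ, h0, h1⟩ := exists_smooth_cutoff (hK.sdiff hU) (hK.sdiff hV) (by
    rw [Set.disjoint_left]
    rintro p ⟨hp, hpU⟩ ⟨-, hpV⟩
    exact (hsub hp).elim hpU hpV)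
  have hρφ := hφ.mul_left hρ
  have hs : tsupport (fun p => ρ p * φ p) ⊆ tsupport φ := tsupport_mul_subset_right
  have h2 : smear α (kern fun p => ρ p * φ p) x = 0 := by
    refine hxU _ hρφ fun p hp => ?_
    by_contra hpU
    refine notMem_tsupport_iff_eventuallyEq.2 ?_ hp
    filter_upwards [h0 p ⟨hs hp, hpU⟩] with q hq
    simp [hq]
  have hd : IsTest fun p => φ p - ρ p * φ p :=
    ⟨hφ.smooth.sub hρφ.smooth, hφ.compact.sub hρφ.compact⟩
  have h3 : smear α (kern fun p => φ p - ρ p * φ p) x = 0 := by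
    refine hxV _ hd fun p hp => ?_
    by_contra hpV
    have hpφ : p ∈ tsupport φ := by
      have := tsupport_sub φ (fun p => ρ p * φ p) hp
      exact this.elim id fun h => hs h
    refine notMem_tsupport_iff_eventuallyEq.2 ?_ hp
    filter_upwards [h1 p ⟨hpφ, hpV⟩] with q hq
    simp [hq]
  rwa [smear_kern_sub hα hφ hρφ, h2, sub_zero] at h3

lemma Sp_inter {F G : Set ℝ} (hF : IsClosed F) (hG : IsClosed G) {x : X} (hxF : x ∈ Sp α F)
    (hxG : x ∈ Sp α G) : x ∈ Sp α (F ∩ G) := by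
  intro φ hφ hd
  refine hα.smear_eq_zero_union hF.isOpen_compl hG.isOpen_compl
    (fun φ hφ h => hxF φ hφ (disjoint_left.2 h)) (fun φ hφ h => hxG φ hφ (disjoint_left.2 h))
    φ hφ ?_
  rw [← compl_inter]
  exact disjoint_left.1 hd

/-! ### Comparison with the Arveson spectrum -/

lemma norm_apply_sub_le {χ : ℝ → ℂ} (hχ : IsTest χ) {ε : ℝ} (hε : 0 < ε) (γ : ℝ) {w : X}
    (hw : smear α (kern fun p => χ (ε⁻¹ * (p - γ))) w = w) (s : ℝ) :
    ‖α s w - Complex.exp (-(Complex.I * γ * s)) • w‖ ≤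
      (∫ t, ‖kern χ (t - ε * s) - kern χ t‖) * ‖w‖ := by
  have hχε : IsTest fun p => χ (ε⁻¹ * p) := isTest_comp_mul hχ (inv_ne_zero hε.ne')
  have hχγ : IsTest fun p => χ (ε⁻¹ * (p - γ)) := isTest_comp_sub hχε γ
  set k := kern fun p => χ (ε⁻¹ * p) with hk
  set K := kern fun p => χ (ε⁻¹ * (p - γ)) with hK
  have hKk : ∀ t, K t = Complex.exp (Complex.I * γ * t) * k t := fun t =>
    kern_comp_sub (fun p => χ (ε⁻¹ * p)) γ t
  have hkχ : ∀ t, k t = ε * kern χ (ε * t) := fun t => by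
    rw [hk, kern_comp_mul χ (inv_pos.2 hε), inv_inv]
  have h1 : α s w = ∫ t, K (t - s) • α t w := by
    conv_lhs => rw [← hw]
    rw [hα.apply_smear hχγ.kern_integrable]
    refine (integral_sub_right_eq_self (μ := volume) (fun t => K t • α (s + t) w) s).symm.trans ?_
    simp only [add_sub_cancel]
  have h2 : Complex.exp (-(Complex.I * γ * s)) • w =
      ∫ t, (Complex.exp (-(Complex.I * γ * s)) * K t) • α t w := by
    conv_lhs => rw [← hw, smear, ← integral_smul]
    simp only [smul_smul]
  have i1 : Integrable fun t => K (t - s) := hχγ.kern_integrable.comp_sub_right s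
  have i2 : Integrable fun t => Complex.exp (-(Complex.I * γ * s)) * K t :=
    hχγ.kern_integrable.const_mul _
  rw [h1, h2, ← integral_sub (hα.smear_integrable i1 w) (hα.smear_integrable i2 w),
    ← integral_mul_const]
  have h3 := Measure.integral_comp_mul_left
    (fun t => ‖kern χ (t - ε * s) - kern χ t‖ * ‖w‖) ε
  rw [abs_of_pos (inv_pos.2 hε), smul_eq_mul] at h3
  have h4 : ∫ t, ‖kern χ (t - ε * s) - kern χ t‖ * ‖w‖ =
      ∫ t, ε * (‖kern χ (ε * t - ε * s) - kern χ (ε * t)‖ * ‖w‖) := by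
    rw [integral_const_mul, h3, mul_inv_cancel_left₀ hε.ne']
  rw [h4]
  have hki := hχε.kern_integrable
  refine norm_integral_le_of_norm_le ?_ (Eventually.of_forall fun t => ?_)
  · have := ((hki.comp_sub_right s).sub hki).norm.mul_const ‖w‖
    refine this.congr (Eventually.of_forall fun t => ?_)
    simp only [Pi.sub_apply, ← hk]
    rw [hkχ, hkχ, ← mul_sub, norm_mul, Complex.norm_real, Real.norm_of_nonneg hε.le, mul_sub ε,
      mul_assoc]
  · have h5 : K (t - s) - Complex.exp (-(Complex.I * γ * s)) * K t =
        Complex.exp (Complex.I * γ * (t - s)) * (k (t - s) - k t) := by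
      rw [hKk, hKk, ← mul_assoc, ← Complex.exp_add, mul_sub]
      push_cast
      congr 3
      ring
    rw [← sub_smul, norm_smul, h5, norm_mul, Complex.norm_exp, hkχ, hkχ, ← mul_sub, norm_mul,
      Complex.norm_real, Real.norm_of_nonneg hε.le, mul_sub ε, mul_assoc, mul_assoc ε]
    have h6 : (Complex.I * γ * (t - s)).re = 0 := by simp
    rw [h6, Real.exp_zero, one_mul]
    gcongr
    exact hα.norm_le t w

lemma exists_smear_kern_eq_zero {g : ℝ → ℂ} (hg : Integrable g) {x : X} (hx : smear α g x = 0)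
    {γ : ℝ} (hγ : fourierT g γ ≠ 0) :
    ∃ δ > 0, ∀ φ, IsTest φ → tsupport φ ⊆ Metric.ball γ δ → smear α (kern φ) x = 0 := by
  obtain ⟨χ, hχ, -, hχ1⟩ := exists_isTest (isCompact_closedBall (0 : ℝ) 1) isOpen_univ
    (subset_univ _)
  set ω : ℝ → ℝ := fun u => ∫ t, ‖kern χ (t - u) - kern χ t‖ with hω
  have hωm : StronglyMeasurable ω := by
    refine StronglyMeasurable.integral_prod_right'
      (f := fun p : ℝ × ℝ => ‖kern χ (p.2 - p.1) - kern χ p.2‖) ?_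
    have := hχ.kern_continuous
    exact Continuous.stronglyMeasurable (by fun_prop)
  have hω0 : ∀ u, 0 ≤ ω u := fun u => integral_nonneg fun t => norm_nonneg _
  have hωb : ∀ u, ω u ≤ 2 * ∫ t, ‖kern χ t‖ := by
    intro u
    have i := hχ.kern_integrable
    have h1 : ∫ t, ‖kern χ (t - u)‖ = ∫ t, ‖kern χ t‖ :=
      integral_sub_right_eq_self (μ := volume) (fun t => ‖kern χ t‖) u
    calc ω u ≤ ∫ t, (‖kern χ (t - u)‖ + ‖kern χ t‖) :=
          integral_mono ((i.comp_sub_right u).sub i).norm ((i.comp_sub_right u).norm.add i.norm)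
            fun t => norm_sub_le _ _
      _ = _ := by rw [integral_add (i.comp_sub_right u).norm i.norm, h1, two_mul]
  have hlim : Tendsto (fun ε : ℝ => ∫ s, ‖g s‖ * ω (ε * s)) (𝓝[>] 0) (𝓝 0) := by
    have : (0 : ℝ) = ∫ s : ℝ, (0 : ℝ) := by simp
    rw [this]
    refine tendsto_integral_filter_of_dominated_convergence
      (fun s => ‖g s‖ * (2 * ∫ t, ‖kern χ t‖)) ?_ ?_ (hg.norm.mul_const _) ?_
    · refine Eventually.of_forall fun ε => hg.aestronglyMeasurable.norm.mul ?_
      exact (hωm.comp_measurable (measurable_const_mul ε)).aestronglyMeasurable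
    · refine Eventually.of_forall fun ε => Eventually.of_forall fun s => ?_
      rw [norm_mul, norm_norm, Real.norm_of_nonneg (hω0 _)]
      gcongr
      exact hωb _
    · refine Eventually.of_forall fun s => ?_
      have h1 : Tendsto (fun ε : ℝ => ε * s) (𝓝[>] 0) (𝓝 0) := by
        have : Continuous fun ε : ℝ => ε * s := by fun_prop
        simpa using (this.tendsto 0).mono_left nhdsWithin_le_nhds
      simpa using ((tendsto_integral_kern_sub hχ).comp h1).const_mul ‖g s‖
  obtain ⟨ε, hεlt, hε⟩ := ((hlim.eventually_lt_const (norm_pos_iff.2 hγ)).and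
    self_mem_nhdsWithin).exists
  replace hε : 0 < ε := hε
  refine ⟨ε, hε, fun φ hφ hsub => ?_⟩
  set w := smear α (kern φ) x with hwdef
  have hχγ : IsTest fun p => χ (ε⁻¹ * (p - γ)) :=
    isTest_comp_sub (isTest_comp_mul hχ (inv_ne_zero hε.ne')) γ
  have hw : smear α (kern fun p => χ (ε⁻¹ * (p - γ))) w = w := by
    rw [hwdef, hα.smear_kern_kern hχγ hφ]
    congr 2
    ext p
    by_cases hp : φ p = 0
    · simp [hp]
    · have h1 : |p - γ| < ε := by simpa [Real.dist_eq] using hsub (subset_tsupport _ hp)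
      have h2 : ε⁻¹ * (p - γ) ∈ Metric.closedBall (0 : ℝ) 1 := by
        rw [mem_closedBall_zero_iff, norm_mul, Real.norm_of_nonneg (inv_pos.2 hε).le,
          Real.norm_eq_abs, ← div_eq_inv_mul]
        exact (div_le_one hε).2 h1.le
      rw [(hχ1 _ h2).eq_of_nhds, one_mul]
  have hgw : smear α g w = 0 := by
    rw [hwdef, hα.smear_comm hg hφ.kern_integrable, hx]
    exact map_zero (hα.smearCLM hφ.kern_integrable)
  have i1 : Integrable fun s : ℝ => g s * Complex.exp (-(Complex.I * γ * s)) := by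
    refine hg.mul_bdd (c := 1) (by fun_prop) (Eventually.of_forall fun t => ?_)
    rw [Complex.norm_exp]
    simp
  have h3 : fourierT g γ • w =
      -∫ s, g s • (α s w - Complex.exp (-(Complex.I * γ * s)) • w) := by
    have h4 : ∀ s, g s • (α s w - Complex.exp (-(Complex.I * γ * s)) • w) =
        g s • α s w - (g s * Complex.exp (-(Complex.I * γ * s))) • w := fun s => by
      rw [smul_sub, smul_smul]
    simp only [h4]
    rw [integral_sub (hα.smear_integrable hg w) (i1.smul_const w), integral_smul_const]
    have h5 : ∫ s, g s • α s w = 0 := hgw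
    rw [h5, zero_sub, neg_neg, fourierT]
  have h6 : ‖fourierT g γ‖ * ‖w‖ ≤ (∫ s, ‖g s‖ * ω (ε * s)) * ‖w‖ := by
    rw [← norm_smul, h3, norm_neg, ← integral_mul_const]
    refine norm_integral_le_of_norm_le ?_ (Eventually.of_forall fun s => ?_)
    · refine Integrable.mul_const ?_ _
      refine (hg.norm.mul_const (2 * ∫ t, ‖kern χ t‖)).mono ?_ (Eventually.of_forall fun s => ?_)
      · refine hg.aestronglyMeasurable.norm.mul ?_
        exact (hωm.comp_measurable (measurable_const_mul ε)).aestronglyMeasurable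
      · rw [norm_mul, norm_norm, Real.norm_of_nonneg (hω0 _), norm_mul, norm_norm]
        gcongr
        exact (hωb _).trans (le_abs_self _)
    · rw [norm_smul, mul_assoc ‖g s‖]
      gcongr
      exact hα.norm_apply_sub_le hχ hε γ hw s
  by_contra hw0
  have := le_of_mul_le_mul_right h6 (norm_pos_iff.2 hw0)
  exact absurd this (not_le.2 hεlt)

lemma specC_eq_Sp {F : Set ℝ} (hF : IsClosed F) : specC α F = Sp α F := by
  ext x
  constructor
  · intro hx φ hφ hd
    have key : ∃ U, IsOpen U ∧ tsupport φ ⊆ U ∧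
        ∀ ψ, IsTest ψ → tsupport ψ ⊆ U → smear α (kern ψ) x = 0 := by
      refine IsCompact.induction_on (p := fun s => ∃ U, IsOpen U ∧ s ⊆ U ∧
        ∀ ψ, IsTest ψ → tsupport ψ ⊆ U → smear α (kern ψ) x = 0) hφ.compact ?_ ?_ ?_ ?_
      · refine ⟨∅, isOpen_empty, subset_rfl, fun ψ _ h => ?_⟩
        have h0 : ψ = fun _ => 0 := tsupport_eq_empty_iff.1 (subset_empty_iff.1 h)
        rw [h0, smear_kern_zero]
      · rintro s t hst ⟨U, hU, htU, h⟩
        exact ⟨U, hU, hst.trans htU, h⟩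
      · rintro s t ⟨U, hU, hsU, h⟩ ⟨V, hV, htV, h'⟩
        exact ⟨U ∪ V, hU.union hV, union_subset_union hsU htV,
          hα.smear_eq_zero_union hU hV h h'⟩
      · intro γ hγ
        have hγF : γ ∉ elemSpec α x := fun h => disjoint_left.1 hd hγ (hx h)
        simp only [elemSpec, mem_ofPred_eq, not_forall] at hγF
        obtain ⟨g, hg, hgx, hgγ⟩ := hγF
        obtain ⟨δ, hδ, h⟩ := hα.exists_smear_kern_eq_zero hg hgx hgγ
        exact ⟨Metric.ball γ δ, mem_nhdsWithin_of_mem_nhds (Metric.ball_mem_nhds γ hδ),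
          Metric.ball γ δ, Metric.isOpen_ball, subset_rfl, h⟩
    obtain ⟨U, -, hsub, h⟩ := key
    exact h φ hφ hsub
  · intro hx γ hγ
    by_contra hγF
    obtain ⟨χ, hχ, hχF, hχ1⟩ := exists_isTest (isCompact_singleton (x := γ)) hF.isOpen_compl
      (by simpa using hγF)
    have h1 := hγ (kern χ) hχ.kern_integrable (hx χ hχ (disjoint_left.2 hχF))
    rw [hχ.fourierT_kern, (hχ1 γ rfl).eq_of_nhds] at h1
    exact one_ne_zero h1

end IsCStarDynSys

/-! ### Products -/

lemma IsTest.comp_neg_sub_integrable {χ : ℝ → ℂ} (hχ : IsTest χ) (r : ℝ) {k : ℝ → ℂ}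
    (hk : Integrable k) : Integrable fun t => k t * kern χ (r - t) := by
  obtain ⟨K, -, hK⟩ := hχ.kern_schwartz
  obtain ⟨C, hC⟩ : ∃ C, ∀ x, ‖K x‖ ≤ C := by
    obtain ⟨a, -, ha⟩ := K.decay 0 0
    exact ⟨a, fun x => by simpa using ha x⟩
  have := hχ.kern_continuous
  refine hk.mul_bdd (c := ‖((1 / (2 * Real.pi) : ℝ) : ℂ)‖ * C)
    (Continuous.aestronglyMeasurable (by fun_prop)) (Eventually.of_forall fun t => ?_)
  rw [hK, norm_mul]
  gcongr
  exact hC _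

lemma fourierT_mul_kern {η χ : ℝ → ℂ} (hη : IsTest η) (hχ : IsTest χ) (r q : ℝ) :
    fourierT (fun t => kern η t * kern χ (r - t)) q =
      (1 / (2 * Real.pi) : ℝ) * ∫ p : ℝ, χ p * Complex.exp (Complex.I * p * r) * η (p + q) := by
  have h_int : Integrable (fun z : ℝ × ℝ => (kern η z.1 * χ z.2) *
      Complex.exp (Complex.I * z.2 * (r - z.1) - Complex.I * q * z.1))
      (volume.prod volume) := by
    refine (hη.kern_integrable.mul_prod hχ.integrable).mul_bdd (c := 1)
      (Continuous.aestronglyMeasurable (by fun_prop)) (Eventually.of_forall fun z => ?_)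
    rw [Complex.norm_exp]
    simp
  have h1 : ∀ t : ℝ, kern η t * kern χ (r - t) * Complex.exp (-(Complex.I * q * t)) =
      (1 / (2 * Real.pi) : ℝ) * ∫ p : ℝ, (kern η t * χ p) *
      Complex.exp (Complex.I * p * (r - t) - Complex.I * q * t) := by
    intro t
    rw [kern.eq_1 χ, mul_left_comm, mul_assoc, ← integral_const_mul, ← integral_mul_const]
    congr 2
    ext p
    rw [Complex.exp_sub, Complex.exp_neg]
    push_cast
    ring
  have h2 : ∀ p : ℝ, χ p * Complex.exp (Complex.I * p * r) * η (p + q) =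
      ∫ t : ℝ, (kern η t * χ p) *
      Complex.exp (Complex.I * p * (r - t) - Complex.I * q * t) := by
    intro p
    rw [← congrFun hη.fourierT_kern (p + q), fourierT, ← integral_const_mul]
    congr 1
    ext t
    have h3 : Complex.exp (Complex.I * p * (r - t) - Complex.I * q * t) =
        Complex.exp (Complex.I * p * r) * Complex.exp (-(Complex.I * (p + q : ℝ) * t)) := by
      rw [← Complex.exp_add]
      congr 1
      push_cast
      ring
    rw [h3]
    ring
  simp only [fourierT, h1, h2]
  rw [integral_const_mul, integral_integral_swap h_int]

namespace IsCStarDynSys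

variable {α : ℝ → X → X} (hα : IsCStarDynSys α)

include hα

lemma smear_mul {η χ : ℝ → ℂ} (hη : IsTest η) (hχ : IsTest χ) {x : X}
    (hx : smear α (kern χ) x = x) (y : X) :
    smear α (kern η) (x * y) =
      ∫ r, α r x * smear α (fun t => kern η t * kern χ (r - t)) y := by
  have h_int : Integrable (fun z : ℝ × ℝ => (kern η z.2 * kern χ (z.1 - z.2)) •
      (α z.1 x * α z.2 y)) (volume.prod volume) := by
    have h1 := hη.kern_integrable.convolution_integrand (ContinuousLinearMap.mul ℂ ℂ)
      hχ.kern_integrable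
    refine Integrable.smul_bdd (C := ‖x‖ * ‖y‖) h1 ?_ ?_
    · exact (((hα.continuous_orbit x).comp continuous_fst).mul
        ((hα.continuous_orbit y).comp continuous_snd)).aestronglyMeasurable
    · refine Eventually.of_forall fun p => (norm_mul_le _ _).trans ?_
      gcongr
      · exact hα.norm_le _ x
      · exact hα.norm_le _ y
  have h1 : ∀ t, α t x = ∫ r, kern χ (r - t) • α r x := by
    intro t
    conv_lhs => rw [← hx]
    rw [hα.apply_smear hχ.kern_integrable]
    refine (integral_sub_right_eq_self (μ := volume)
      (fun r => kern χ r • α (t + r) x) t).symm.trans ?_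
    simp only [add_sub_cancel]
  have h2 : ∀ t, kern η t • α t (x * y) =
      ∫ r, (kern η t * kern χ (r - t)) • (α r x * α t y) := by
    intro t
    have i := hα.smear_integrable (hχ.kern_integrable.comp_sub_right t) x
    have h3 := ((ContinuousLinearMap.mul ℂ X).flip (α t y)).integral_comp_comm i
    simp only [ContinuousLinearMap.flip_apply, ContinuousLinearMap.mul_apply', smul_mul_assoc]
      at h3
    rw [hα.map_mul, h1 t, ← h3, ← integral_smul]
    simp only [smul_smul]
  have h4 : ∀ r, α r x * smear α (fun t => kern η t * kern χ (r - t)) y =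
      ∫ t, (kern η t * kern χ (r - t)) • (α r x * α t y) := by
    intro r
    have i := hα.smear_integrable (hχ.comp_neg_sub_integrable r hη.kern_integrable) y
    have h3 := (ContinuousLinearMap.mul ℂ X (α r x)).integral_comp_comm i
    simp only [ContinuousLinearMap.mul_apply', mul_smul_comm] at h3
    rw [smear, ← h3]
  simp only [h4]
  rw [smear]
  simp only [h2]
  exact (integral_integral_swap h_int).symm

lemma mul_mem_Sp {a b c d : ℝ} (hab : a ≤ b) (hcd : c ≤ d) {x y : X} (hx : x ∈ Sp α (Icc a b))
    (hy : y ∈ Sp α (Icc c d)) : x * y ∈ Sp α (Icc (a + c) (b + d)) := by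
  intro η hη hd
  obtain ⟨δ, hδ, hdδ⟩ := hd.symm.exists_cthickenings isCompact_Icc (isClosed_tsupport η)
  obtain ⟨χ, hχ, hχs, hχ1⟩ := exists_isTest (isCompact_Icc (a := a) (b := b))
    (isOpen_Ioo (a := a - δ / 2) (b := b + δ / 2)) fun p hp => ⟨by linarith [hp.1], by linarith [hp.2]⟩
  obtain ⟨ψ, hψ, hψs, hψ1⟩ := exists_isTest (isCompact_Icc (a := c) (b := d))
    (isOpen_Ioo (a := c - δ / 2) (b := d + δ / 2)) fun p hp => ⟨by linarith [hp.1], by linarith [hp.2]⟩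
  have hη0 : ∀ p, a + c - δ ≤ p → p ≤ b + d + δ → η p = 0 := by
    intro p h1 h2
    by_contra hp
    refine disjoint_right.1 hdδ
      (Metric.self_subset_cthickening (tsupport η) (subset_tsupport _ hp)) ?_
    rcases le_total p (a + c) with h | h
    · refine Metric.mem_cthickening_of_dist_le p (a + c) _ _ ⟨le_rfl, by linarith⟩ ?_
      rw [Real.dist_eq, abs_le]
      constructor <;> linarith
    rcases le_total p (b + d) with h' | h'
    · exact Metric.self_subset_cthickening _ ⟨h, h'⟩
    · refine Metric.mem_cthickening_of_dist_le p (b + d) _ _ ⟨by linarith, le_rfl⟩ ?_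
      rw [Real.dist_eq, abs_le]
      constructor <;> linarith
  rw [hα.smear_mul hη hχ (hα.smear_kern_eq_self hx hχ hχ1)]
  have h0 : ∀ r, smear α (fun t => kern η t * kern χ (r - t)) y = 0 := by
    intro r
    rw [← hα.smear_kern_eq_self hy hψ hψ1]
    refine hα.smear_smear_eq_zero (hχ.comp_neg_sub_integrable r hη.kern_integrable)
      hψ.kern_integrable (fun q => ?_) y
    rw [hψ.fourierT_kern]
    by_cases hq : ψ q = 0
    · rw [hq, mul_zero]
    have hq' := hψs (subset_tsupport _ hq)
    rw [fourierT_mul_kern hη hχ]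
    have : ∀ p : ℝ, χ p * Complex.exp (Complex.I * p * r) * η (p + q) = 0 := by
      intro p
      by_cases hp : χ p = 0
      · simp [hp]
      have hp' := hχs (subset_tsupport _ hp)
      rw [hη0 (p + q) (by linarith [hp'.1, hq'.1]) (by linarith [hp'.2, hq'.2]), mul_zero]
    simp [this]
  simp [h0]

end IsCStarDynSys

/-! ### Spectral subspaces of half-lines -/

lemma closedSpan_subset {S : Set X} {M : Submodule ℂ X} (hM : IsClosed (M : Set X))
    (h : S ⊆ M) : ClosedSpan S ⊆ M :=
  closure_minimal (SetLike.coe_subset_coe.2 (Submodule.span_le.2 h)) hM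

lemma subset_closedSpan (S : Set X) : S ⊆ ClosedSpan S :=
  Submodule.subset_span.trans subset_closure

namespace IsCStarDynSys

variable {α : ℝ → X → X} (hα : IsCStarDynSys α)

include hα

lemma Sp_Icc_subset_specO {U : Set ℝ} (hU : IsOpen U) {a b : ℝ} (h : Icc a b ⊆ U) :
    Sp α (Icc a b) ⊆ specO α univ U := by
  intro x hx
  obtain ⟨χ, hχ, hχs, hχ1⟩ := exists_isTest isCompact_Icc hU h
  refine subset_closedSpan _ ⟨x, mem_univ x, kern χ, hχ.kern_integrable, ?_, ?_, ?_⟩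
  · rw [hχ.fourierT_kern]
    exact hχ.compact
  · rwa [hχ.fourierT_kern]
  · exact (hα.smear_kern_eq_self hx hχ hχ1).symm

lemma specO_subset {U : Set ℝ} (hU : U.OrdConnected) {M : Submodule ℂ X}
    (hM : IsClosed (M : Set X)) (h : ∀ a b, a ≤ b → Icc a b ⊆ U → Sp α (Icc a b) ⊆ M) :
    specO α univ U ⊆ M := by
  refine closedSpan_subset hM ?_
  rintro _ ⟨x, -, f, hf, hc, hs, rfl⟩
  rcases (tsupport (fourierT f)).eq_empty_or_nonempty with h0 | hne
  · have h1 : fourierT f = 0 := tsupport_eq_empty_iff.1 h0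
    rw [hα.smear_eq_zero hf (fun γ => congrFun h1 γ) x]
    exact zero_mem M
  obtain ⟨a, ha⟩ := hc.exists_isLeast hne
  obtain ⟨b, hb⟩ := hc.exists_isGreatest hne
  exact h a b (ha.2 hb.1) (hU.out (hs ha.1) (hs hb.1))
    (hα.smear_mem_Sp hf x fun p hp => ⟨ha.2 hp, hb.2 hp⟩)

/-- Elements with spectrum in `[0,∞)` are approximated by elements with compact spectrum. -/
lemma Sp_Ici_subset {M : Submodule ℂ X} (hM : IsClosed (M : Set X))
    (h : ∀ b, 0 ≤ b → Sp α (Icc 0 b) ⊆ M) : Sp α (Ici 0) ⊆ M := by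
  intro x hx
  obtain ⟨φ, hφ, -, hφ0⟩ := exists_isTest (isCompact_singleton (x := (0 : ℝ))) isOpen_univ
    (subset_univ _)
  have l := hα.tendsto_smear_kern_comp_mul hφ x
  rw [(hφ0 0 rfl).eq_of_nhds, one_smul] at l
  refine hM.mem_of_tendsto l ?_
  filter_upwards [self_mem_nhdsWithin] with ε hε
  have hε' : 0 < ε := hε
  have hφε := isTest_comp_mul hφ hε'.ne'
  obtain ⟨b, hb⟩ := hφε.compact.isCompact.bddAbove
  refine h (max b 0) (le_max_right _ _) (Sp_mono ?_ (hα.smear_kern_mem_Sp hφε hx))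
  exact fun p hp => ⟨hp.1, (hb hp.2).trans (le_max_left _ _)⟩

end IsCStarDynSys

/-! ### Maximality and simple ideals -/

/-- `ClosedSpan` as a submodule. -/
def cspan (S : Set X) : Submodule ℂ X := (Submodule.span ℂ S).topologicalClosure

lemma isClosed_closedSpan (S : Set X) : IsClosed (ClosedSpan S) := isClosed_closure

lemma mul_mem_of_closedSpan_left {S : Set X} {y : X} {M : Submodule ℂ X}
    (hM : IsClosed (M : Set X)) (h : ∀ s ∈ S, s * y ∈ M) {x : X} (hx : x ∈ ClosedSpan S) :
    x * y ∈ M :=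
  closedSpan_subset (M := M.comap (LinearMap.mulRight ℂ y))
    (hM.preimage (continuous_mul_const y)) h hx

lemma mul_mem_of_closedSpan_right {S : Set X} {x : X} {M : Submodule ℂ X}
    (hM : IsClosed (M : Set X)) (h : ∀ s ∈ S, x * s ∈ M) {y : X} (hy : y ∈ ClosedSpan S) :
    x * y ∈ M :=
  closedSpan_subset (M := M.comap (LinearMap.mulLeft ℂ x))
    (hM.preimage (continuous_const_mul x)) h hy

/-- The image of a submodule under the involution. -/
def starSubmodule (M : Submodule ℂ X) : Submodule ℂ X where
  carrier := star (M : Set X)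
  zero_mem' := by simp
  add_mem' := fun {x y} hx hy => by
    simp only [mem_star, star_add] at hx hy ⊢
    exact M.add_mem hx hy
  smul_mem' := fun c x hx => by
    simp only [mem_star, star_smul] at hx ⊢
    exact M.smul_mem _ hx

lemma isClosed_starSubmodule {M : Submodule ℂ X} (hM : IsClosed (M : Set X)) :
    IsClosed (starSubmodule M : Set X) := hM.preimage continuous_star

lemma star_mem_closedSpan {S : Set X} {x : X} (hx : x ∈ ClosedSpan S) :
    star x ∈ ClosedSpan (star S) :=
  closedSpan_subset (M := starSubmodule (cspan (star S)))
    (isClosed_starSubmodule (isClosed_closedSpan _))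
    (fun s hs => subset_closedSpan _ (by simpa using hs)) hx

lemma closedSpan_invariant {α : ℝ → X → X} (hα : IsCStarDynSys α) {S : Set X}
    (hS : Invariant α S) : Invariant α (ClosedSpan S) := fun t _ hx =>
  closedSpan_subset (M := (cspan S).comap (hα.clm t : X →ₗ[ℂ] X))
    ((isClosed_closedSpan S).preimage (hα.clm t).continuous)
    (fun s hs => subset_closedSpan _ (hS t s hs)) hx

lemma IsSubalgebra.star_set {B : Set X} (h : IsSubalgebra B) : IsSubalgebra (star B) := by
  obtain ⟨h0, ha, hs, hm⟩ := h
  refine ⟨by simpa using h0, fun x hx y hy => ?_, fun c x hx => ?_, fun x hx y hy => ?_⟩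
  · simpa using ha _ hx _ hy
  · simpa using hs (star c) _ hx
  · simpa using hm _ hy _ hx

lemma IsMaximalClosedSubalgebra.star_set {B : Set X} (h : IsMaximalClosedSubalgebra B) :
    IsMaximalClosedSubalgebra (star B) := by
  obtain ⟨hc, hs, hn, hm⟩ := h
  refine ⟨hc.preimage continuous_star, hs.star_set, fun h => hn ?_, fun W hW hWs hBW => ?_⟩
  · rw [← star_star B, h, star_univ]
  · refine (hm (star W) (hW.preimage continuous_star) hWs.star_set fun x hx =>
      hBW (by simpa using hx)).imp (fun h => ?_) fun h => ?_
    · rw [← h, star_star]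
    · rw [← star_star W, h, star_univ]

/-- `T` is an `α`-invariant bimodule over `A`. -/
structure IsInvBimodule (α : ℝ → X → X) (A T : Set X) : Prop where
  inv : Invariant α T
  left : ∀ a ∈ A, ∀ s ∈ T, a * s ∈ T
  right : ∀ s ∈ T, ∀ a ∈ A, s * a ∈ T

lemma IsInvBimodule.star_set {α : ℝ → X → X} (hα : IsCStarDynSys α) {A T : Set X}
    (h : IsInvBimodule α A T) : IsInvBimodule α (star A) (star T) where
  inv := fun t x hx => by simpa [hα.map_star] using h.inv t _ hx
  left := fun a ha s hs => by simpa using h.right _ hs _ ha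
  right := fun s hs a ha => by simpa using h.left _ ha _ hs

/-- The algebraic situation produced by the positive spectral subspaces `A = X^α([0,∞))`,
`S₀ = X^α((0,∞))` and two further ones contained in `S₀`. -/
structure HalfLineData (α : ℝ → X → X) (Y A S₀ S S' : Set X) : Prop where
  dyn : IsCStarDynSys α
  ideal : IsClosedTwoSidedIdealIn (univ : Set X) Y
  ideal_inv : Invariant α Y
  ideal_simple : AlphaSimple α Y
  max : IsMaximalClosedSubalgebra A
  bim₀ : IsInvBimodule α A S₀
  bim : IsInvBimodule α A S
  bim' : IsInvBimodule α A S'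
  sub : S ⊆ S₀
  sub' : S' ⊆ S₀
  sub_alg : S₀ ⊆ A
  sub_ideal : S₀ ⊆ Y
  star_ideal : ∀ y ∈ Y, star y ∈ Y
  disj : ∀ x ∈ S₀, star x ∈ A → x = 0
  ne : ∃ s ∈ S, s ≠ 0
  ne' : ∃ s ∈ S', s ≠ 0
  lower : ∃ m ∈ S₀, m ≠ 0 ∧ ∀ s ∈ S', s * star m ∈ S₀ ∧ star m * s ∈ S₀

namespace HalfLineData

variable {α : ℝ → X → X} {Y A S₀ S S' : Set X}

lemma star_set (D : HalfLineData α Y A S₀ S S') :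
    HalfLineData α Y (star A) (star S₀) (star S) (star S') where
  dyn := D.dyn
  ideal := D.ideal
  ideal_inv := D.ideal_inv
  ideal_simple := D.ideal_simple
  max := D.max.star_set
  bim₀ := D.bim₀.star_set D.dyn
  bim := D.bim.star_set D.dyn
  bim' := D.bim'.star_set D.dyn
  sub := fun x hx => D.sub hx
  sub' := fun x hx => D.sub' hx
  sub_alg := fun x hx => D.sub_alg hx
  sub_ideal := fun x hx => by simpa using D.star_ideal _ (D.sub_ideal hx)
  star_ideal := D.star_ideal
  disj := fun x hx hxA => by simpa using D.disj (star x) hx hxA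
  ne := by
    obtain ⟨s, hs, h⟩ := D.ne
    exact ⟨star s, by simpa using hs, by simpa using h⟩
  ne' := by
    obtain ⟨s, hs, h⟩ := D.ne'
    exact ⟨star s, by simpa using hs, by simpa using h⟩
  lower := by
    obtain ⟨m, hm, h, hs⟩ := D.lower
    refine ⟨star m, by simpa using hm, by simpa using h, fun s hsS => ?_⟩
    obtain ⟨h1, h2⟩ := hs _ hsS
    exact ⟨by simpa using h2, by simpa using h1⟩

section

variable (D : HalfLineData α Y A S₀ S S')

include D

lemma ideal_subset {T : Set X} (h : T ⊆ Y) : ClosedSpan T ⊆ Y :=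
  closedSpan_subset (M :=
    { carrier := Y
      zero_mem' := D.ideal.2.2.1
      add_mem' := fun {x y} hx hy => D.ideal.2.2.2.1 x hx y hy
      smul_mem' := fun c x hx => D.ideal.2.2.2.2.1 c x hx }) D.ideal.2.1 h

lemma mul_mem_ideal (x : X) {y : X} (hy : y ∈ Y) : x * y ∈ Y :=
  (D.ideal.2.2.2.2.2 x (mem_univ x) y hy).1

lemma mem_ideal_mul (x : X) {y : X} (hy : y ∈ Y) : y * x ∈ Y :=
  (D.ideal.2.2.2.2.2 x (mem_univ x) y hy).2

/-- A nonzero invariant closed span inside `Y` which is stable under multiplication is `Y`. -/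
lemma closedSpan_eq_ideal {T : Set X} (hT : Invariant α T) (hTY : T ⊆ Y)
    (hl : ∀ x, ∀ s ∈ T, x * s ∈ ClosedSpan T) (hr : ∀ x, ∀ s ∈ T, s * x ∈ ClosedSpan T)
    (hne : ∃ s ∈ T, s ≠ 0) : ClosedSpan T = Y := by
  have hsub := D.ideal_subset hTY
  refine (D.ideal_simple (ClosedSpan T) ⟨hsub, isClosed_closedSpan T, zero_mem (cspan T),
    fun x hx y hy => (cspan T).add_mem hx hy, fun c x hx => (cspan T).smul_mem c hx,
    fun x _ k hk => ⟨?_, ?_⟩⟩ (closedSpan_invariant D.dyn hT)).resolve_left fun h => ?_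
  · exact mul_mem_of_closedSpan_right (M := cspan T) (isClosed_closedSpan T) (hl x) hk
  · exact mul_mem_of_closedSpan_left (M := cspan T) (isClosed_closedSpan T) (hr x) hk
  · obtain ⟨s, hs, hs0⟩ := hne
    exact hs0 (by simpa [h] using subset_closedSpan T hs)

/-- The dichotomy for the closed left ideal generated by an invariant right `A`-module. -/
lemma dichotomy {P : Set X} (hP : Invariant α P) (hPY : P ⊆ Y)
    (hPA : ∀ p ∈ P, ∀ a ∈ A, p * a ∈ P) (hne : ∃ p ∈ P, p ≠ 0) :
    ClosedSpan (MulSet2 univ P) = Y ∨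
      ∀ w, (∀ p ∈ P, p * w ∈ ClosedSpan (MulSet2 univ P)) → w ∈ A := by
  set L := ClosedSpan (MulSet2 univ P) with hL
  have hLc : IsClosed L := isClosed_closedSpan _
  have hleft : ∀ x, ∀ y ∈ L, x * y ∈ L := fun x y hy => by
    refine mul_mem_of_closedSpan_right (M := cspan (MulSet2 univ P)) hLc ?_ hy
    rintro _ ⟨z, -, p, hp, rfl⟩
    exact subset_closedSpan _ ⟨x * z, mem_univ _, p, hp, by rw [mul_assoc]⟩
  have hidz : ∀ w, (∀ p ∈ P, p * w ∈ L) → ∀ y ∈ L, y * w ∈ L := fun w hw y hy => by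
    refine mul_mem_of_closedSpan_left (M := cspan (MulSet2 univ P)) hLc ?_ hy
    rintro _ ⟨z, -, p, hp, rfl⟩
    rw [mul_assoc]
    exact hleft z _ (hw p hp)
  let W : Set X := {w | ∀ y ∈ L, y * w ∈ L}
  have hWc : IsClosed W := by
    have : W = ⋂ y ∈ L, (fun w => y * w) ⁻¹' L := by
      ext w
      simp [W]
    rw [this]
    exact isClosed_biInter fun y _ => hLc.preimage (continuous_const_mul y)
  have hWs : IsSubalgebra W := by
    refine ⟨fun y _ => ?_, fun x hx z hz y hy => ?_, fun c x hx y hy => ?_,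
      fun x hx z hz y hy => ?_⟩
    · rw [mul_zero]
      exact zero_mem (cspan (MulSet2 univ P))
    · rw [mul_add]
      exact (cspan (MulSet2 univ P)).add_mem (hx y hy) (hz y hy)
    · rw [mul_smul_comm]
      exact (cspan (MulSet2 univ P)).smul_mem c (hx y hy)
    · rw [← mul_assoc]
      exact hz _ (hx y hy)
  have hAW : A ⊆ W := by
    intro a ha y hy
    refine mul_mem_of_closedSpan_left (M := cspan (MulSet2 univ P)) hLc ?_ hy
    rintro _ ⟨z, -, p, hp, rfl⟩
    exact subset_closedSpan _ ⟨z, mem_univ _, p * a, hPA p hp a ha, by rw [mul_assoc]⟩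
  rcases D.max.2.2.2 W hWc hWs hAW with h | h
  · right
    intro w hw
    rw [← h]
    exact hidz w hw
  · left
    refine D.closedSpan_eq_ideal ?_ ?_ ?_ ?_ ?_
    · rintro t _ ⟨z, -, p, hp, rfl⟩
      exact ⟨α t z, mem_univ _, α t p, hP t p hp, D.dyn.map_mul t z p⟩
    · rintro _ ⟨z, -, p, hp, rfl⟩
      exact D.mul_mem_ideal z (hPY hp)
    · exact fun x s hs => hleft x s (subset_closedSpan _ hs)
    · intro x s hs
      have hx : x ∈ W := h ▸ mem_univ x
      exact hx s (subset_closedSpan _ hs)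
    · obtain ⟨p, hp, hp0⟩ := hne
      exact ⟨star p * p, ⟨star p, mem_univ _, p, hp, rfl⟩,
        fun h0 => hp0 (CStarRing.star_mul_self_eq_zero_iff p |>.1 h0)⟩

lemma dichotomy' {P : Set X} (hP : Invariant α P) (hPY : P ⊆ Y)
    (hPA : ∀ p ∈ P, ∀ a ∈ A, p * a ∈ P) (hne : ∃ p ∈ P, p ≠ 0) :
    ClosedSpan (MulSet2 univ P) = Y ∨ ClosedSpan (MulSet2 univ P) ⊆ A := by
  refine (D.dichotomy hP hPY hPA hne).imp_right fun h w hw => h w fun p _ => ?_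
  refine mul_mem_of_closedSpan_right (M := cspan (MulSet2 univ P)) (isClosed_closedSpan _) ?_ hw
  rintro _ ⟨z, -, q, hq, rfl⟩
  exact subset_closedSpan _ ⟨p * z, mem_univ _, q, hq, by rw [mul_assoc]⟩

lemma mul_eq_zero_of_subset {P : Set X} (hPA : ClosedSpan (MulSet2 univ P) ⊆ A) {p s : X}
    (hp : p ∈ P) (hs : s ∈ S₀) : p * s = 0 := by
  have h1 : ∀ x, x * p ∈ A := fun x => hPA (subset_closedSpan _ ⟨x, mem_univ x, p, hp, rfl⟩)
  have h2 : star p * p * s = 0 := by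
    refine D.disj _ (D.bim₀.left _ (h1 _) s hs) ?_
    rw [star_mul, star_mul, star_star, ← mul_assoc]
    exact h1 _
  rw [← CStarRing.star_mul_self_eq_zero_iff, star_mul, mul_assoc, ← mul_assoc (star p), h2,
    mul_zero]

/-- If `p` annihilates a generating set of `Y` as a right ideal then `p ∈ Y` vanishes. -/
lemma eq_zero_of_mul_eq_zero {T : Set X} (hT : ClosedSpan (MulSet2 univ (star T)) = Y) {p : X}
    (hp : p ∈ Y) (h : ∀ s ∈ T, p * s = 0) : p = 0 := by
  have h1 : p ∈ ClosedSpan (MulSet2 univ (star T)) := hT ▸ hp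
  have h2 : p * star p ∈ (⊥ : Submodule ℂ X) := by
    refine mul_mem_of_closedSpan_left (by simp) ?_ h1
    rintro _ ⟨z, -, t, ht, rfl⟩
    have h3 := congrArg star (h _ ht)
    rw [star_mul, star_star, star_zero] at h3
    simp [mul_assoc, h3]
  exact (CStarRing.mul_star_self_eq_zero_iff p).1 (by simpa using h2)

lemma ne₀ : ∃ s ∈ S₀, s ≠ 0 := by
  obtain ⟨s, hs, h⟩ := D.ne
  exact ⟨s, D.sub hs, h⟩

lemma left_ideal_eq : ClosedSpan (MulSet2 univ S₀) = Y := by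
  refine (D.dichotomy' D.bim₀.inv D.sub_ideal D.bim₀.right D.ne₀).resolve_right fun hA => ?_
  have hkill : ∀ s ∈ S₀, ∀ t ∈ S₀, s * t = 0 := fun s hs t ht =>
    D.mul_eq_zero_of_subset hA hs ht
  have D' := D.star_set
  rcases D'.dichotomy' D'.bim₀.inv D'.sub_ideal D'.bim₀.right D'.ne₀ with h | h
  · obtain ⟨s, hs, hs0⟩ := D.ne₀
    exact hs0 (D.eq_zero_of_mul_eq_zero h (D.sub_ideal hs) (hkill s hs))
  · obtain ⟨m, hm, hm0, hms⟩ := D.lower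
    have h1 : ∀ s ∈ S', s * star m = 0 := by
      intro s hs
      refine D.disj _ (hms s hs).1 ?_
      exact h (subset_closedSpan _ ⟨s, mem_univ s, star m, by simpa using hm, rfl⟩)
    rcases D.dichotomy D.bim'.inv (D.sub'.trans D.sub_ideal) D.bim'.right D.ne' with h2 | h2
    · have hYA : Y ⊆ A := by
        rw [← h2]
        refine (closure_mono ?_).trans hA
        refine SetLike.coe_subset_coe.2 (Submodule.span_mono ?_)
        rintro _ ⟨z, hz, s, hs, rfl⟩
        exact ⟨z, hz, s, D.sub' hs, rfl⟩
      exact hm0 (D.disj m hm (hYA (D.star_ideal m (D.sub_ideal hm))))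
    · refine hm0 (D.disj m hm (h2 _ fun p hp => ?_))
      rw [h1 p hp]
      exact zero_mem (cspan _)

lemma left_ideal_eq_of_module {P : Set X} (hP : Invariant α P) (hPY : P ⊆ Y)
    (hPA : ∀ p ∈ P, ∀ a ∈ A, p * a ∈ P) (hne : ∃ p ∈ P, p ≠ 0) :
    ClosedSpan (MulSet2 univ P) = Y := by
  refine (D.dichotomy' hP hPY hPA hne).resolve_right fun hA => ?_
  obtain ⟨p, hp, hp0⟩ := hne
  exact hp0 (D.eq_zero_of_mul_eq_zero D.star_set.left_ideal_eq (hPY hp)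
    fun s hs => D.mul_eq_zero_of_subset hA hp hs)

lemma closedSpan_mul_self : ClosedSpan (MulSet2 Y Y) = Y := by
  refine D.closedSpan_eq_ideal ?_ ?_ ?_ ?_ ?_
  · rintro t _ ⟨x, hx, y, hy, rfl⟩
    exact ⟨_, D.ideal_inv t x hx, _, D.ideal_inv t y hy, D.dyn.map_mul t x y⟩
  · rintro _ ⟨x, -, y, hy, rfl⟩
    exact D.mul_mem_ideal x hy
  · rintro z _ ⟨x, hx, y, hy, rfl⟩
    exact subset_closedSpan _ ⟨z * x, D.mul_mem_ideal z hx, y, hy, by rw [mul_assoc]⟩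
  · rintro z _ ⟨x, hx, y, hy, rfl⟩
    exact subset_closedSpan _ ⟨x, hx, y * z, D.mem_ideal_mul z hy, by rw [mul_assoc]⟩
  · obtain ⟨s, hs, hs0⟩ := D.ne₀
    exact ⟨star s * s, ⟨star s, D.star_ideal s (D.sub_ideal hs), s, D.sub_ideal hs, rfl⟩,
      fun h0 => hs0 ((CStarRing.star_mul_self_eq_zero_iff s).1 h0)⟩

/-- The span of `S* Z S` is the whole ideal. -/
lemma closedSpan_star_eq {Z : Set X} (hZinv : Invariant α Z) (hZne : ∃ z ∈ Z, z ∈ Y ∧ z ≠ 0)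
    (hZ : ∀ z ∈ Z, ∀ x, ∀ z' ∈ Z, star z * x * z' ∈ Z) :
    ClosedSpan (MulSet3 (star S) Z S) = Y := by
  have hSY : S ⊆ Y := D.sub.trans D.sub_ideal
  have hL : ClosedSpan (MulSet2 univ (MulSet2 Z S)) = Y := by
    refine D.left_ideal_eq_of_module ?_ ?_ ?_ ?_
    · rintro t _ ⟨z, hz, s, hs, rfl⟩
      exact ⟨_, hZinv t z hz, _, D.bim.inv t s hs, D.dyn.map_mul t z s⟩
    · rintro _ ⟨z, -, s, hs, rfl⟩
      exact D.mul_mem_ideal z (hSY hs)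
    · rintro _ ⟨z, hz, s, hs, rfl⟩ a ha
      exact ⟨z, hz, s * a, D.bim.right s hs a ha, by rw [mul_assoc]⟩
    · obtain ⟨z, hz, hzY, hz0⟩ := hZne
      by_contra! h
      have D' := D.star_set
      exact hz0 (D.eq_zero_of_mul_eq_zero (D'.left_ideal_eq_of_module D'.bim.inv
        (D'.sub.trans D'.sub_ideal) D'.bim.right D'.ne) hzY
        fun s hs => h _ ⟨z, hz, s, hs, rfl⟩)
  refine Subset.antisymm (D.ideal_subset ?_) ?_
  · rintro _ ⟨r, -, z, -, s, hs, rfl⟩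
    exact D.mul_mem_ideal _ (hSY hs)
  · rw [← D.closedSpan_mul_self]
    refine closedSpan_subset (M := cspan _) (isClosed_closedSpan _) ?_
    rintro _ ⟨x, hx, y, hy, rfl⟩
    replace hx := star_mem_closedSpan (hL ▸ D.star_ideal x hx :
      star x ∈ ClosedSpan (MulSet2 univ (MulSet2 Z S)))
    rw [star_star] at hx
    rw [← hL] at hy
    refine mul_mem_of_closedSpan_left (isClosed_closedSpan _) (fun u hu => ?_) hx
    refine mul_mem_of_closedSpan_right (isClosed_closedSpan _) (fun v hv => ?_) hy
    obtain ⟨a, -, _, ⟨z, hz, s, hs, rfl⟩, hu'⟩ := hu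
    obtain ⟨b, -, _, ⟨z', hz', s', hs', rfl⟩, rfl⟩ := hv
    refine subset_closedSpan _ ⟨star s, by simpa using hs, _, hZ z hz (star a * b) z' hz', s', hs',
      ?_⟩
    rw [← star_star u, hu']
    simp only [star_mul, mul_assoc]

end

end HalfLineData

/-! ### The half-line subspaces of a dynamical system -/

namespace IsCStarDynSys

variable {α : ℝ → X → X} (hα : IsCStarDynSys α)

include hα

lemma specO_univ_mono {U V : Set ℝ} (h : U ⊆ V) : specO α univ U ⊆ specO α univ V := by
  refine closedSpan_subset (M := cspan _) (isClosed_closedSpan _) ?_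
  rintro _ ⟨x, hx, f, hf, hc, hs, rfl⟩
  exact subset_closedSpan _ ⟨x, hx, f, hf, hc, hs.trans h, rfl⟩

lemma specO_univ_invariant (U : Set ℝ) : Invariant α (specO α univ U) := by
  refine closedSpan_invariant hα ?_
  rintro t _ ⟨x, -, f, hf, hc, hs, rfl⟩
  exact ⟨α t x, mem_univ _, f, hf, hc, hs, hα.apply_smear' hf t x⟩

lemma specO_subset_Sp {U F : Set ℝ} (h : U ⊆ F) : specO α univ U ⊆ Sp α F := by
  refine closedSpan_subset (M := hα.spSubmodule F) (hα.isClosed_Sp F) ?_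
  rintro _ ⟨x, -, f, hf, -, hs, rfl⟩
  exact hα.smear_mem_Sp hf x (hs.trans h)

lemma star_mem_Sp_Icc {a b : ℝ} {x : X} (hx : x ∈ Sp α (Icc a b)) :
    star x ∈ Sp α (Icc (-b) (-a)) := by
  simpa using hα.star_mem_Sp hx

lemma star_mem_specO {U : Set ℝ} (hU : IsOpen U) (hUc : U.OrdConnected) {x : X}
    (hx : x ∈ specO α univ U) : star x ∈ specO α univ (-U) := by
  refine hα.specO_subset hUc (M := starSubmodule (cspan _))
    (isClosed_starSubmodule (isClosed_closedSpan _)) (fun a b hab h y hy => ?_) hx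
  refine hα.Sp_Icc_subset_specO hU.neg ?_ (hα.star_mem_Sp_Icc hy)
  intro p hp
  exact h ⟨by linarith [hp.2], by linarith [hp.1]⟩

lemma specO_Iio_eq (γ : ℝ) : specO α univ (Iio (-γ)) = star (specO α univ (Ioi γ)) := by
  ext x
  constructor
  · intro hx
    simpa using hα.star_mem_specO isOpen_Iio ordConnected_Iio hx
  · intro hx
    simpa using hα.star_mem_specO isOpen_Ioi ordConnected_Ioi hx

lemma mul_mem_specO_Ioi {γ γ' c d : ℝ} (hcd : c ≤ d) (h : γ ≤ γ' + c) {x y : X}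
    (hx : x ∈ specO α univ (Ioi γ')) (hy : y ∈ Sp α (Icc c d)) :
    x * y ∈ specO α univ (Ioi γ) := by
  refine hα.specO_subset ordConnected_Ioi
    (M := (cspan _ : Submodule ℂ X).comap (LinearMap.mulRight ℂ y))
    ((isClosed_closedSpan _).preimage (continuous_mul_const y)) (fun a b hab hs z hz => ?_) hx
  refine hα.Sp_Icc_subset_specO isOpen_Ioi ?_ (hα.mul_mem_Sp hab hcd hz hy)
  intro p hp
  have := hs ⟨le_rfl, hab⟩
  simp only [mem_Ioi] at this ⊢
  linarith [hp.1]

lemma mem_specO_Ioi_mul {γ γ' c d : ℝ} (hcd : c ≤ d) (h : γ ≤ γ' + c) {x y : X}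
    (hx : x ∈ specO α univ (Ioi γ')) (hy : y ∈ Sp α (Icc c d)) :
    y * x ∈ specO α univ (Ioi γ) := by
  refine hα.specO_subset ordConnected_Ioi
    (M := (cspan _ : Submodule ℂ X).comap (LinearMap.mulLeft ℂ y))
    ((isClosed_closedSpan _).preimage (continuous_const_mul y)) (fun a b hab hs z hz => ?_) hx
  refine hα.Sp_Icc_subset_specO isOpen_Ioi ?_ (hα.mul_mem_Sp hcd hab hy hz)
  intro p hp
  have := hs ⟨le_rfl, hab⟩
  simp only [mem_Ioi] at this ⊢
  linarith [hp.1]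

lemma isInvBimodule_specO (γ : ℝ) :
    IsInvBimodule α (specC α (Ici 0)) (specO α univ (Ioi γ)) where
  inv := hα.specO_univ_invariant _
  left := fun a ha s hs => by
    rw [hα.specC_eq_Sp isClosed_Ici] at ha
    refine hα.Sp_Ici_subset (M := (cspan _ : Submodule ℂ X).comap (LinearMap.mulRight ℂ s))
      ((isClosed_closedSpan _).preimage (continuous_mul_const s)) (fun b hb y hy => ?_) ha
    exact hα.mem_specO_Ioi_mul hb (by simp) hs hy
  right := fun s hs a ha => by
    rw [hα.specC_eq_Sp isClosed_Ici] at ha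
    refine hα.Sp_Ici_subset (M := (cspan _ : Submodule ℂ X).comap (LinearMap.mulLeft ℂ s))
      ((isClosed_closedSpan _).preimage (continuous_const_mul s)) (fun b hb y hy => ?_) ha
    exact hα.mul_mem_specO_Ioi hb (by simp) hs hy

/-- Averages over narrow spectral windows at `0` vanish in the limit on `X^α((0,∞))`. -/
lemma tendsto_smear_kern_narrow {φ : ℝ → ℂ} (hφ : IsTest φ) {x : X}
    (hx : x ∈ specO α univ (Ioi 0)) :
    Tendsto (fun ε : ℝ => smear α (kern fun p => φ (ε⁻¹ * p)) x) (𝓝[>] 0) (𝓝 0) := by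
  have hφε : ∀ ε : ℝ, 0 < ε → IsTest fun p => φ (ε⁻¹ * p) := fun ε hε =>
    isTest_comp_mul hφ (inv_ne_zero hε.ne')
  let M : Submodule ℂ X :=
    { carrier := {x | Tendsto (fun ε : ℝ => smear α (kern fun p => φ (ε⁻¹ * p)) x)
        (𝓝[>] 0) (𝓝 0)}
      zero_mem' := by
        refine tendsto_const_nhds.congr' ?_
        filter_upwards [self_mem_nhdsWithin] with ε hε
        exact (map_zero (hα.smearCLM (hφε ε hε).kern_integrable)).symm
      add_mem' := fun {x y} hx hy => by
        have h := Tendsto.add hx hy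
        rw [add_zero] at h
        refine h.congr' ?_
        filter_upwards [self_mem_nhdsWithin] with ε hε
        exact (_root_.map_add (hα.smearCLM (hφε ε hε).kern_integrable) x y).symm
      smul_mem' := fun c x hx => by
        have h := Tendsto.const_smul hx c
        rw [smul_zero] at h
        refine h.congr' ?_
        filter_upwards [self_mem_nhdsWithin] with ε hε
        exact (map_smul (hα.smearCLM (hφε ε hε).kern_integrable) c x).symm }
  have hM : IsClosed (M : Set X) := by
    refine isClosed_of_closure_subset fun x hx => ?_
    refine Metric.tendsto_nhds.2 fun η hη => ?_
    set C := ∫ s, ‖kern φ s‖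
    have hC : 0 ≤ C := integral_nonneg fun _ => norm_nonneg _
    obtain ⟨y, hy, hxy⟩ := Metric.mem_closure_iff.1 hx (η / (2 * (C + 1))) (by positivity)
    have hy' : Tendsto (fun ε : ℝ => smear α (kern fun p => φ (ε⁻¹ * p)) y) (𝓝[>] 0) (𝓝 0) := hy
    filter_upwards [Metric.tendsto_nhds.1 hy' (η / 2) (half_pos hη), self_mem_nhdsWithin]
      with ε h1 hε
    have hsub := map_sub (hα.smearCLM (hφε ε hε).kern_integrable) x y
    simp only [smearCLM_apply] at hsub
    have h2 := hα.norm_smear_kern_comp_mul_le hφ (inv_pos.2 hε) (x - y)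
    rw [hsub] at h2
    rw [dist_eq_norm] at hxy
    rw [dist_zero_right] at h1 ⊢
    have h3 : C * ‖x - y‖ < η / 2 := by
      calc C * ‖x - y‖ ≤ (C + 1) * ‖x - y‖ := by gcongr; linarith
        _ < (C + 1) * (η / (2 * (C + 1))) := by gcongr
        _ = η / 2 := by field_simp
    have h4 := norm_le_norm_add_norm_sub' (smear α (kern fun p => φ (ε⁻¹ * p)) x)
      (smear α (kern fun p => φ (ε⁻¹ * p)) y)
    linarith
  refine hα.specO_subset ordConnected_Ioi hM (fun a b hab hs y hy => ?_) hx
  have ha : 0 < a := hs ⟨le_rfl, hab⟩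
  obtain ⟨R, hR⟩ := hφ.compact.isCompact.bddAbove
  have hR' : (0 : ℝ) < |R| + 1 := by positivity
  refine tendsto_const_nhds.congr' ?_
  filter_upwards [Ioo_mem_nhdsGT (div_pos ha hR')] with ε hε
  refine (hy _ (hφε ε hε.1) ?_).symm
  rw [disjoint_left]
  intro p hp hpab
  have h1 : ε⁻¹ * p ∈ tsupport φ :=
    tsupport_comp_subset_preimage φ (by fun_prop : Continuous fun p : ℝ => ε⁻¹ * p) hp
  have h2 : ε⁻¹ * p ≤ |R| := (hR h1).trans (le_abs_self R)
  have h3 : ε * (|R| + 1) < a := (lt_div_iff₀ hR').1 hε.2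
  have h4 : p ≤ ε * |R| := by
    rwa [← div_eq_inv_mul, div_le_iff₀ hε.1, mul_comm] at h2
  linarith [hpab.1, hε.1]

lemma eq_zero_of_star_mem {x : X} (hx : x ∈ specO α univ (Ioi 0))
    (hxs : star x ∈ specC α (Ici 0)) : x = 0 := by
  rw [hα.specC_eq_Sp isClosed_Ici] at hxs
  have h1 : x ∈ Sp α (Ici 0) := hα.specO_subset_Sp Ioi_subset_Ici_self hx
  have h2 : x ∈ Sp α (Iic 0) := by simpa using hα.star_mem_Sp hxs
  have h3 := hα.Sp_inter isClosed_Ici isClosed_Iic h1 h2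
  obtain ⟨φ, hφ, -, hφ0⟩ := exists_isTest (isCompact_singleton (x := (0 : ℝ))) isOpen_univ
    (subset_univ _)
  refine tendsto_nhds_unique (tendsto_const_nhds.congr' ?_) (hα.tendsto_smear_kern_narrow hφ hx)
  filter_upwards [self_mem_nhdsWithin] with ε hε
  have hε' : (0 : ℝ) < ε := hε
  refine (hα.smear_kern_eq_self h3 (isTest_comp_mul hφ (inv_ne_zero hε'.ne')) ?_).symm
  rintro p ⟨hp1, hp2⟩
  obtain rfl : p = 0 := le_antisymm hp2 hp1
  have h4 : Tendsto (fun p : ℝ => ε⁻¹ * p) (𝓝 0) (𝓝 0) := by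
    have : Continuous fun p : ℝ => ε⁻¹ * p := by fun_prop
    simpa using this.tendsto 0
  exact h4.eventually (hφ0 0 rfl)

lemma smear_mem_of_isClosed {M : Submodule ℂ X} (hM : IsClosed (M : Set X))
    (hMinv : Invariant α (M : Set X)) {f : ℝ → ℂ} (hf : Integrable f) {x : X} (hx : x ∈ M) :
    smear α f x ∈ M := by
  have : CompleteSpace M := hM.completeSpace_coe
  let u : ℝ → M := fun t => ⟨α t x, hMinv t x hx⟩
  have hu : Integrable fun t => f t • u t :=
    hf.smul_bdd (C := ‖x‖)
      ((hα.continuous_orbit x).subtype_mk fun t => hMinv t x hx).aestronglyMeasurable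
      (Eventually.of_forall fun t => hα.norm_le t x)
  have h := M.subtypeL.integral_comp_comm hu
  have h2 : smear α f x = M.subtypeL (∫ t, f t • u t) := by
    rw [← h]
    rfl
  rw [h2]
  exact (∫ t, f t • u t).2

lemma exists_ne_zero_of_mem_actSpec {γ : ℝ} (h : γ ∈ actSpec α univ) {ε : ℝ} (hε : 0 < ε) :
    ∃ x ∈ Sp α (Icc (γ - ε) (γ + ε)), x ≠ 0 := by
  have h1 := h ε hε
  rw [univ_inter, hα.specC_eq_Sp isClosed_Icc] at h1
  by_contra! h2
  exact h1 (Subset.antisymm (fun x hx => h2 x hx)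
    (singleton_subset_iff.2 (zero_mem (hα.spSubmodule _))))

lemma exists_ne_zero_of_abs {γ : ℝ} (h : γ ∈ actSpec α univ) {ε : ℝ} (hε : 0 < ε) :
    ∃ x ∈ Sp α (Icc (|γ| - ε) (|γ| + ε)), x ≠ 0 := by
  obtain ⟨x, hx, hx0⟩ := hα.exists_ne_zero_of_mem_actSpec h hε
  rcases abs_choice γ with h | h <;> rw [h]
  · exact ⟨x, hx, hx0⟩
  · refine ⟨star x, ?_, by simpa using hx0⟩
    convert hα.star_mem_Sp_Icc hx using 3 <;> ring

omit hα in
lemma exists_abs_lt_abs_of_four {E : Set ℝ} (h : ∃ a b c d : ℝ, a ∈ E ∧ b ∈ E ∧ c ∈ E ∧ d ∈ E ∧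
    a ≠ b ∧ a ≠ c ∧ a ≠ d ∧ b ≠ c ∧ b ≠ d ∧ c ≠ d) :
    ∃ u ∈ E, ∃ v ∈ E, 0 < |u| ∧ |u| < |v| := by
  obtain ⟨a, b, c, d, ha, hb, hc, hd, hab, hac, had, hbc, hbd, hcd⟩ := h
  by_contra! hE
  have heq : ∀ u ∈ E, ∀ v ∈ E, u ≠ 0 → v ≠ 0 → u ≠ v → u = -v := by
    intro u hu v hv hu0 hv0 huv
    have := le_antisymm (hE v hv u hu (abs_pos.2 hv0)) (hE u hu v hv (abs_pos.2 hu0))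
    exact (abs_eq_abs.1 this).resolve_left huv
  have key : ∀ u ∈ E, ∀ v ∈ E, ∀ w ∈ E, u ≠ 0 → v ≠ 0 → w ≠ 0 → u ≠ v → u ≠ w → v = w := by
    intro u hu v hv w hw hu0 hv0 hw0 huv huw
    linarith [heq u hu v hv hu0 hv0 huv, heq u hu w hw hu0 hw0 huw]
  by_cases ha0 : a = 0
  · subst ha0
    exact hcd (key b hb c hc d hd hab.symm hac.symm had.symm hbc hbd)
  by_cases hb0 : b = 0
  · subst hb0
    exact hcd (key a ha c hc d hd ha0 hbc.symm hbd.symm hac had)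
  by_cases hc0 : c = 0
  · subst hc0
    exact hbd (key a ha b hb d hd ha0 hb0 hcd.symm hab had)
  · exact hbc (key a ha b hb c hc ha0 hb0 hc0 hab hac)

end IsCStarDynSys

/-- A hereditary subalgebra `Z` of an ideal satisfies `Z X Z ⊆ Z`. -/
lemma IsHereditaryIn.star_mul_mul_mem {Y Z : Set X} (hZ : IsHereditaryIn Y Z)
    (hY : ∀ x, ∀ y ∈ Y, x * y ∈ Y) {z z' : X} (hz : z ∈ Z) (hz' : z' ∈ Z) (x : X) :
    star z * x * z' ∈ Z := by
  obtain ⟨hZY, -, ⟨⟨h0, hadd, hsmul, hmul⟩, hstar⟩, hher⟩ := hZ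
  let _ : NonUnitalCStarAlgebra X := {}
  have hdiag : ∀ w ∈ Z, ∀ x, star w * x * w ∈ Z := by
    intro w hw x
    let M : Submodule ℂ X :=
      { carrier := {x | star w * x * w ∈ Z}
        zero_mem' := by simpa using h0
        add_mem' := fun {x y} hx hy => by
          simpa [mul_add, add_mul] using hadd _ hx _ hy
        smul_mem' := fun c x hx => by
          simpa [mul_smul_comm, smul_mul_assoc] using hsmul c _ hx }
    have hM : Submodule.span ℂ {a : X | 0 ≤ a} ≤ M := by
      refine Submodule.span_le.2 fun a ha => ?_
      refine hher _ (hY _ _ (hZY hw)) ((‖a‖ : ℂ) • (star w * w))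
        (hsmul _ _ (hmul _ (hstar w hw) w hw)) (star_left_conjugate_nonneg ha w) ?_
      have := CStarAlgebra.star_left_conjugate_le_norm_smul (a := w) (b := a)
        (IsSelfAdjoint.of_nonneg ha)
      simpa using this
    have hx : x ∈ M := hM (by rw [CStarAlgebra.span_nonneg]; trivial)
    exact hx
  have hp : ∀ u ∈ Z, ∀ v ∈ Z, star u * x * v + star v * x * u ∈ Z := by
    intro u hu v hv
    have h1 := hadd _ (hdiag _ (hadd u hu v hv) x) _
      (hsmul (-1) _ (hadd _ (hdiag u hu x) _ (hdiag v hv x)))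
    convert h1 using 1
    simp only [star_add, add_mul, mul_add, neg_smul, one_smul]
    abel
  have h2 := hsmul (1 / 2) _ (hadd _ (hp z hz z' hz') _
    (hsmul Complex.I _ (hp _ (hsmul Complex.I z hz) z' hz')))
  convert h2 using 1
  simp only [star_smul, Complex.star_def, Complex.conj_I, smul_mul_assoc, mul_smul_comm,
    smul_add, smul_smul, neg_smul, smul_neg, neg_mul, Complex.I_mul_I, one_smul]
  module

variable {α : ℝ → X → X}

/-- A closed invariant ideal with `Y^α((0,∞)) = X^α((0,∞))` contains `X^α((0,∞))`. -/
lemma specO_Ioi_subset_ideal (hα : IsCStarDynSys α) {Y : Set X}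
    (hY : IsClosedTwoSidedIdealIn (univ : Set X) Y) (hYinv : Invariant α Y)
    (hYpos : specO α Y (Ioi (0 : ℝ)) = specO α (univ : Set X) (Ioi (0 : ℝ))) :
    specO α (univ : Set X) (Ioi (0 : ℝ)) ⊆ Y := by
  obtain ⟨-, hcl, h0, hadd, hsmul, -⟩ := hY
  let M : Submodule ℂ X :=
    { carrier := Y
      zero_mem' := h0
      add_mem' := fun {x y} hx hy => hadd x hx y hy
      smul_mem' := fun c x hx => hsmul c x hx }
  rw [← hYpos]
  refine closedSpan_subset (M := M) hcl ?_
  rintro _ ⟨x, hx, f, hf, -, -, rfl⟩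
  exact hα.smear_mem_of_isClosed (M := M) hcl hYinv hf hx

/-- An `α`-simple closed invariant ideal is selfadjoint. -/
lemma AlphaSimple.star_mem (hα : IsCStarDynSys α) {Y : Set X} (hsimple : AlphaSimple α Y)
    (hY : IsClosedTwoSidedIdealIn (univ : Set X) Y) (hYinv : Invariant α Y)
    {y : X} (hy : y ∈ Y) : star y ∈ Y := by
  by_cases hy0 : y = 0
  · simpa [hy0] using hY.2.2.1
  obtain ⟨-, hcl, h0, hadd, hsmul, hmul⟩ := hY
  have hK : IsClosedTwoSidedIdealIn Y (Y ∩ star Y) := by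
    refine ⟨inter_subset_left, hcl.inter (hcl.preimage continuous_star), ⟨h0, by simpa using h0⟩,
      fun x hx y hy => ⟨hadd _ hx.1 _ hy.1, ?_⟩, fun c x hx => ⟨hsmul c _ hx.1, ?_⟩,
      fun s hs k hk => ⟨⟨(hmul s (mem_univ s) k hk.1).1, ?_⟩,
        ⟨(hmul s (mem_univ s) k hk.1).2, ?_⟩⟩⟩
    · simpa using hadd _ hx.2 _ hy.2
    · simpa using hsmul (star c) _ hx.2
    · simpa using (hmul (star s) (mem_univ _) _ hk.2).2
    · simpa using (hmul (star s) (mem_univ _) _ hk.2).1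
  have hKinv : Invariant α (Y ∩ star Y) := fun t x hx =>
    ⟨hYinv t x hx.1, by simpa [hα.map_star] using hYinv t _ hx.2⟩
  rcases hsimple _ hK hKinv with h | h
  · refine absurd ?_ hy0
    have h1 : star y * y ∈ Y := (hmul (star y) (mem_univ _) y hy).1
    have h2 : star y * y ∈ Y ∩ star Y := ⟨h1, by simpa using h1⟩
    rw [h, mem_singleton_iff] at h2
    exact CStarRing.star_mul_self_eq_zero_iff y |>.1 h2
  · exact (h.symm ▸ hy : y ∈ Y ∩ star Y).2

/-- The half-line spectral subspaces of a system with at least four spectral values. -/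
lemma exists_halfLineData (hα : IsCStarDynSys α)
    (hfour : ∃ a b c d : ℝ, a ∈ actSpec α (univ : Set X) ∧ b ∈ actSpec α (univ : Set X) ∧
      c ∈ actSpec α (univ : Set X) ∧ d ∈ actSpec α (univ : Set X) ∧
      a ≠ b ∧ a ≠ c ∧ a ≠ d ∧ b ≠ c ∧ b ≠ d ∧ c ≠ d)
    (hmax : IsMaximalClosedSubalgebra (specC α (Ici (0 : ℝ))))
    {Y : Set X} (hY : IsClosedTwoSidedIdealIn (univ : Set X) Y)
    (hYinv : Invariant α Y) (hYsimple : AlphaSimple α Y)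
    (hYpos : specO α Y (Ioi (0 : ℝ)) = specO α (univ : Set X) (Ioi (0 : ℝ)))
    {γ : ℝ} (hγ : 0 ≤ γ) (hne : (actSpec α (univ : Set X) ∩ Ioi γ).Nonempty) :
    ∃ S', HalfLineData α Y (specC α (Ici 0)) (specO α univ (Ioi 0)) (specO α univ (Ioi γ)) S' := by
  obtain ⟨u, hu, v, hv, hu0, huv⟩ := IsCStarDynSys.exists_abs_lt_abs_of_four hfour
  obtain ⟨δ, hδ, hδ1, hδ2⟩ : ∃ δ > 0, δ ≤ |u| / 2 ∧ δ ≤ (|v| - |u|) / 4 :=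
    ⟨min (|u| / 2) ((|v| - |u|) / 4), lt_min (by linarith) (by linarith),
      min_le_left _ _, min_le_right _ _⟩
  refine ⟨specO α univ (Ioi ((|u| + |v|) / 2)), ?_⟩
  constructor
  · exact hα
  · exact hY
  · exact hYinv
  · exact hYsimple
  · exact hmax
  · exact hα.isInvBimodule_specO 0
  · exact hα.isInvBimodule_specO γ
  · exact hα.isInvBimodule_specO _
  · exact hα.specO_univ_mono (Ioi_subset_Ioi hγ)
  · exact hα.specO_univ_mono (Ioi_subset_Ioi (by linarith))
  · rw [hα.specC_eq_Sp isClosed_Ici]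
    exact hα.specO_subset_Sp Ioi_subset_Ici_self
  · exact specO_Ioi_subset_ideal hα hY hYinv hYpos
  · exact fun y hy => hYsimple.star_mem hα hY hYinv hy
  · exact fun x hx hxs => hα.eq_zero_of_star_mem hx hxs
  · obtain ⟨β, hβ, hβγ⟩ := hne
    rw [mem_Ioi] at hβγ
    obtain ⟨x, hx, hx0⟩ := hα.exists_ne_zero_of_mem_actSpec hβ (half_pos (sub_pos.2 hβγ))
    exact ⟨x, hα.Sp_Icc_subset_specO isOpen_Ioi
      (fun t ht => by rw [mem_Ioi]; linarith [ht.1]) hx, hx0⟩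
  · obtain ⟨x, hx, hx0⟩ := hα.exists_ne_zero_of_abs hv hδ
    exact ⟨x, hα.Sp_Icc_subset_specO isOpen_Ioi
      (fun t ht => by rw [mem_Ioi]; linarith [ht.1]) hx, hx0⟩
  · obtain ⟨m, hm, hm0⟩ := hα.exists_ne_zero_of_abs hu hδ
    have hstar := hα.star_mem_Sp_Icc hm
    refine ⟨m, hα.Sp_Icc_subset_specO isOpen_Ioi
      (fun t ht => by rw [mem_Ioi]; linarith [ht.1]) hm, hm0, fun s hs => ⟨?_, ?_⟩⟩
    · exact hα.mul_mem_specO_Ioi (by linarith) (by linarith) hs hstar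
    · exact hα.mem_specO_Ioi_mul (by linarith) (by linarith) hs hstar

/-- **Lemma 4.14.** If `sp(α)` contains more than three points and `X^α([0,∞))` is maximal,
then, with `Y` the `α`-simple ideal of Lemma 4.10, for every `Z` which is either `X` or a
nonzero `α`-invariant hereditary C*-subalgebra of `Y`, and every `γ ≥ 0` with
`sp(α) ∩ (γ,∞) ≠ ∅`, the closed spans of `X^α((−∞,−γ)) Z X^α((γ,∞))` and of
`X^α((γ,∞)) Z X^α((−∞,−γ))` both equal `Y`. -/
theorem spans_eq_ideal (α : ℝ → X → X) (hα : IsCStarDynSys α)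
    (hfour : ∃ a b c d : ℝ, a ∈ actSpec α (univ : Set X) ∧ b ∈ actSpec α (univ : Set X) ∧
      c ∈ actSpec α (univ : Set X) ∧ d ∈ actSpec α (univ : Set X) ∧
      a ≠ b ∧ a ≠ c ∧ a ≠ d ∧ b ≠ c ∧ b ≠ d ∧ c ≠ d)
    (hmax : IsMaximalClosedSubalgebra (specC α (Ici (0 : ℝ))))
    (Y : Set X) (hY : IsClosedTwoSidedIdealIn (univ : Set X) Y)
    (hYinv : Invariant α Y) (hYsimple : AlphaSimple α Y)
    (hYpos : specO α Y (Ioi (0 : ℝ)) = specO α (univ : Set X) (Ioi (0 : ℝ)))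
    (hYdense : closure (Y + specC α (Ici (0 : ℝ))) = (univ : Set X))
    (Z : Set X)
    (hZ : Z = (univ : Set X) ∨
      (IsHereditaryIn Y Z ∧ Z ≠ ({0} : Set X) ∧ Invariant α Z)) :
    ∀ γ : ℝ, 0 ≤ γ → (actSpec α (univ : Set X) ∩ Ioi γ).Nonempty →
      ClosedSpan (MulSet3 (specO α (univ : Set X) (Iio (-γ))) Z
        (specO α (univ : Set X) (Ioi γ))) = Y ∧
      ClosedSpan (MulSet3 (specO α (univ : Set X) (Ioi γ)) Z
        (specO α (univ : Set X) (Iio (-γ)))) = Y := by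
  intro γ hγ hne
  obtain ⟨S', D⟩ := exists_halfLineData hα hfour hmax hY hYinv hYsimple hYpos hγ hne
  have hZ' : Invariant α Z ∧ (∃ z ∈ Z, z ∈ Y ∧ z ≠ 0) ∧
      ∀ z ∈ Z, ∀ x, ∀ z' ∈ Z, star z * x * z' ∈ Z := by
    rcases hZ with rfl | ⟨hher, hZ0, hZinv⟩
    · obtain ⟨s, hs, hs0⟩ := D.ne₀
      exact ⟨fun _ _ _ => mem_univ _, ⟨s, mem_univ s, D.sub_ideal hs, hs0⟩,
        fun _ _ _ _ _ => mem_univ _⟩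
    · refine ⟨hZinv, ?_, fun z hz x z' hz' =>
        hher.star_mul_mul_mem (fun x y hy => D.mul_mem_ideal x hy) hz hz' x⟩
      by_contra! h
      exact hZ0 (subset_antisymm (fun z hz => h z hz (hher.1 hz))
        (singleton_subset_iff.2 hher.2.2.1.1.1))
  obtain ⟨hZinv, hZne, hZmul⟩ := hZ'
  rw [hα.specO_Iio_eq]
  exact ⟨D.closedSpan_star_eq hZinv hZne hZmul,
    by simpa using D.star_set.closedSpan_star_eq hZinv hZne hZmul⟩

end PeligradMax
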